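/- arXiv:1809.07128 — 9 statements merged into one kernel-verified Lean document; each statement's English description precedes it below -/
import Mathlib

section
/- Let a < b be real numbers, let h_n, h : (a,b) → [0,∞) be Lebesgue integrable functions with h_n → h in L¹((a,b)) and ∫_a^b h(x) dx > 0, and let (λ_n) be a sequence of positive reals with λ_n → 0. Then there exist a constant μ > 0 and an integer N such that for every n ≥ N, |H_{λ_n}| + (1/λ_n) ∫_{(a,b)\H_{λ_n}} h_n(x) dx > μ, where H_{λ_n} := {x ∈ (a,b) : h_n(x) ≥ λ_n}. -/
open MeasureTheory Filter Set

/-- Lemma 3.1 (Vitali-type lower bound): if `hn → h` in `L¹((a,b))` with `∫ h > 0` and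
`λ_n → 0`, `λ_n > 0`, then the quantity `|H_{λ_n}| + (1/λ_n) ∫_{(a,b)\H_{λ_n}} hn` is
eventually bounded below by a positive constant `μ`. -/
theorem stmt_0 (a b : ℝ) (hab : a < b)
    (hn : ℕ → ℝ → ℝ) (h : ℝ → ℝ)
    (hnint : ∀ n, IntegrableOn (hn n) (Ioo a b))
    (hhint : IntegrableOn h (Ioo a b))
    (hnnonneg : ∀ n, ∀ x ∈ Ioo a b, 0 ≤ hn n x)
    (hhnonneg : ∀ x ∈ Ioo a b, 0 ≤ h x)
    (hL1 : Tendsto (fun n => ∫ x in Ioo a b, |hn n x - h x|) atTop (nhds 0))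
    (hpos : 0 < ∫ x in Ioo a b, h x)
    (lam : ℕ → ℝ) (hlampos : ∀ n, 0 < lam n)
    (hlam0 : Tendsto lam atTop (nhds 0)) :
    ∃ μ > (0 : ℝ), ∃ N : ℕ, ∀ n ≥ N,
      μ < (volume {x ∈ Ioo a b | lam n ≤ hn n x}).toReal
        + (1 / lam n) * ∫ x in {x ∈ Ioo a b | hn n x < lam n}, hn n x := by
  have hE : MeasurableSet (Ioo a b) := measurableSet_Ioo
  have hfin : IsFiniteMeasure (volume.restrict (Ioo a b)) := by
    refine ⟨?_⟩
    simp
  have h1 : Integrable (fun _ : ℝ => (1 : ℝ)) (volume.restrict (Ioo a b)) := integrable_const 1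
  have hmin : Integrable (fun x => min 1 (h x)) (volume.restrict (Ioo a b)) := h1.inf hhint
  have hminn : ∀ n, Integrable (fun x => min 1 (hn n x)) (volume.restrict (Ioo a b)) :=
    fun n => h1.inf (hnint n)
  have hnn : 0 ≤ᵐ[volume.restrict (Ioo a b)] fun x => min 1 (h x) := by
    filter_upwards [ae_restrict_mem hE] with x hx
    exact le_min zero_le_one (hhnonneg x hx)
  have hI : 0 < ∫ x in Ioo a b, min 1 (h x) := by
    rcases (integral_nonneg_of_ae hnn).lt_or_eq with h2 | h2
    · exact h2
    · exfalso
      have h3 := (integral_eq_zero_iff_of_nonneg_ae hnn hmin).1 h2.symm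
      have h4 : ∫ x in Ioo a b, h x = 0 := by
        apply integral_eq_zero_of_ae
        filter_upwards [h3] with x hx
        simp only [Pi.zero_apply] at hx ⊢
        rcases min_choice 1 (h x) with h5 | h5 <;> linarith
      linarith
  refine ⟨(∫ x in Ioo a b, min 1 (h x)) / 2, by positivity, ?_⟩
  have e1 := hL1.eventually (gt_mem_nhds (half_pos hI))
  have e2 := hlam0.eventually (gt_mem_nhds one_pos)
  obtain ⟨N, hN⟩ := eventually_atTop.1 (e1.and e2)
  refine ⟨N, fun n hnN => ?_⟩
  obtain ⟨hd, hl⟩ := hN n hnN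
  have hdint : Integrable (fun x => |hn n x - h x|) (volume.restrict (Ioo a b)) :=
    ((hnint n).sub hhint).abs
  have step1 : ∫ x in Ioo a b, min 1 (h x) ≤
      (∫ x in Ioo a b, min 1 (hn n x)) + ∫ x in Ioo a b, |hn n x - h x| := by
    rw [← integral_add (hminn n) hdint]
    apply integral_mono hmin ((hminn n).add hdint)
    intro x
    have := neg_abs_le (hn n x - h x)
    have h0 := abs_nonneg (hn n x - h x)
    simp only [Pi.add_apply]
    rcases min_choice 1 (hn n x) with h5 | h5 <;> rw [h5]
    · linarith [min_le_left 1 (h x)]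
    · linarith [min_le_right 1 (h x)]
  have hA : NullMeasurableSet {x | hn n x < lam n} (volume.restrict (Ioo a b)) :=
    nullMeasurableSet_lt (hnint n).aemeasurable aemeasurable_const
  have hT : {x ∈ Ioo a b | hn n x < lam n} = {x | hn n x < lam n} ∩ Ioo a b := by
    ext x; simp [and_comm]
  have hS : {x ∈ Ioo a b | lam n ≤ hn n x} = {x | hn n x < lam n}ᶜ ∩ Ioo a b := by
    ext x; simp [and_comm]
  have hvol : (volume {x ∈ Ioo a b | lam n ≤ hn n x}).toReal
      = ∫ x in {x | hn n x < lam n}ᶜ, (1 : ℝ) ∂(volume.restrict (Ioo a b)) := by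
    rw [Measure.restrict_restrict₀ hA.compl, hS]
    simp [Measure.real]
  rw [hvol, hT, ← Measure.restrict_restrict₀ hA]
  have step2 := integral_add_compl₀ hA (hminn n)
  have step3 : ∫ x in {x | hn n x < lam n}ᶜ, min 1 (hn n x) ∂(volume.restrict (Ioo a b))
      ≤ ∫ x in {x | hn n x < lam n}ᶜ, (1 : ℝ) ∂(volume.restrict (Ioo a b)) :=
    integral_mono (hminn n).integrableOn h1.integrableOn fun x => min_le_left _ _
  have step4 : ∫ x in {x | hn n x < lam n}, min 1 (hn n x) ∂(volume.restrict (Ioo a b))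
      ≤ ∫ x in {x | hn n x < lam n}, hn n x ∂(volume.restrict (Ioo a b)) :=
    integral_mono (hminn n).integrableOn (Integrable.integrableOn (hnint n))
      fun x => min_le_right _ _
  have step5 : 0 ≤ ∫ x in {x | hn n x < lam n}, hn n x ∂(volume.restrict (Ioo a b)) := by
    apply integral_nonneg_of_ae
    apply ae_restrict_of_ae
    filter_upwards [ae_restrict_mem hE] with x hx
    exact hnnonneg n x hx
  have step6 := le_mul_of_one_le_left step5 ((one_le_div (hlampos n)).2 hl.le)
  linarith
end

section
/- Let a < b, let h : (a,b) → [0,∞) be integrable with ∫_a^b h dx > 0, and let h_n : (a,b) → [0,∞) be integrable with h_n ≤ h a.e., h_n → h in L¹((a,b)), and ∫_a^b (h − h_n) dx > 0 for every n. Fix r ∈ (0,1) and set λ_n := (∫_a^b (h − h_n) dx)^r, μ_n := |{x ∈ (a,b) : h_n(x) ≥ λ_n}| + (1/λ_n) ∫_{{h_n < λ_n}} h_n dx, and ε_n := (∫_a^b (h − h_n) dx)/μ_n. Then there exist μ > 0 and N such that μ_n > μ for all n ≥ N, and moreover ε_n → 0 and ε_n/λ_n → 0 as n → ∞. -/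
open MeasureTheory Filter Set

/-- With `λ_n := (∫(h−h_n))^r`, `μ_n := |{h_n ≥ λ_n}| + (1/λ_n)∫_{{h_n<λ_n}} h_n`,
`ε_n := (∫(h−h_n))/μ_n`, one has `μ_n > μ > 0` eventually, `ε_n → 0`, and `ε_n/λ_n → 0`. -/
theorem stmt_1 (a b : ℝ) (hab : a < b)
    (h : ℝ → ℝ) (hhint : IntegrableOn h (Ioo a b))
    (hhnonneg : ∀ x ∈ Ioo a b, 0 ≤ h x)
    (hpos : 0 < ∫ x in Ioo a b, h x)
    (hn : ℕ → ℝ → ℝ)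
    (hnint : ∀ n, IntegrableOn (hn n) (Ioo a b))
    (hnnonneg : ∀ n, ∀ x ∈ Ioo a b, 0 ≤ hn n x)
    (hle : ∀ n, ∀ᵐ x ∂(volume.restrict (Ioo a b)), hn n x ≤ h x)
    (hL1 : Tendsto (fun n => ∫ x in Ioo a b, |hn n x - h x|) atTop (nhds 0))
    (hdiff : ∀ n, 0 < ∫ x in Ioo a b, (h x - hn n x))
    (r : ℝ) (hr : r ∈ Ioo (0 : ℝ) 1)
    (lam muf eps : ℕ → ℝ)
    (hlam : ∀ n, lam n = (∫ x in Ioo a b, (h x - hn n x)) ^ r)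
    (hmuf : ∀ n, muf n = (volume {x ∈ Ioo a b | lam n ≤ hn n x}).toReal
        + (1 / lam n) * ∫ x in {x ∈ Ioo a b | hn n x < lam n}, hn n x)
    (heps : ∀ n, eps n = (∫ x in Ioo a b, (h x - hn n x)) / muf n) :
    (∃ μ > (0 : ℝ), ∃ N : ℕ, ∀ n ≥ N, μ < muf n)
      ∧ Tendsto eps atTop (nhds 0)
      ∧ Tendsto (fun n => eps n / lam n) atTop (nhds 0) := by
  obtain ⟨hr0, hr1⟩ := hr
  set ν : Measure ℝ := volume.restrict (Ioo a b) with hν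
  have : IsFiniteMeasure ν := by
    rw [hν]; exact ⟨by simp⟩
  set d : ℕ → ℝ := fun n => ∫ x in Ioo a b, (h x - hn n x) with hd
  have hhint' : Integrable h ν := hhint
  have hnint' : ∀ n, Integrable (hn n) ν := hnint
  have hh0 : ∀ᵐ x ∂ν, 0 ≤ h x := (ae_restrict_iff' measurableSet_Ioo).2 (.of_forall hhnonneg)
  have hn0 : ∀ n, ∀ᵐ x ∂ν, 0 ≤ hn n x :=
    fun n => (ae_restrict_iff' measurableSet_Ioo).2 (.of_forall (hnnonneg n))
  have hd0 : Tendsto d atTop (nhds 0) := by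
    refine hL1.congr (fun n => ?_)
    refine integral_congr_ae ?_
    filter_upwards [hle n] with x hx
    rw [abs_sub_comm, abs_of_nonneg (by linarith)]
  have hlam0 : Tendsto lam atTop (nhds 0) := by
    have := hd0.rpow_const (p := r) (Or.inr hr0.le)
    rw [Real.zero_rpow hr0.ne'] at this
    exact this.congr (fun n => (hlam n).symm)
  have hlampos : ∀ n, 0 < lam n := fun n => by
    rw [hlam n]; exact Real.rpow_pos_of_pos (hdiff n) r
  have hminint : ∀ (f : ℝ → ℝ) (c : ℝ), Integrable f ν → Integrable (fun x => min (f x) c) ν :=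
    fun f c hf => hf.inf (integrable_const c)
  have hI : Tendsto (fun k : ℕ => ∫ x, min (h x) (k : ℝ) ∂ν) atTop (nhds (∫ x, h x ∂ν)) := by
    refine tendsto_integral_of_dominated_convergence h
      (fun k => (hminint h k hhint').aestronglyMeasurable) hhint' ?_ ?_
    · intro k
      filter_upwards [hh0] with x hx
      rw [Real.norm_eq_abs, abs_of_nonneg (le_min hx (Nat.cast_nonneg k))]
      exact min_le_left _ _
    · refine .of_forall (fun x => ?_)
      refine tendsto_const_nhds.congr' ?_
      filter_upwards [tendsto_natCast_atTop_atTop.eventually_ge_atTop (h x)] with k hk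
      exact (min_eq_left hk).symm
  set I : ℝ := ∫ x, h x ∂ν with hIdef
  have hIpos : 0 < I := hpos
  obtain ⟨k, hk, hk1⟩ := ((hI.eventually (lt_mem_nhds (show 3 * I / 4 < I by linarith))).and
    (eventually_ge_atTop 1)).exists
  have hk1' : (1 : ℝ) ≤ k := by exact_mod_cast hk1
  have hkpos : (0 : ℝ) < k := by linarith
  have key : ∀ n, d n < I / 4 → lam n < 1 → I / 2 / k < muf n := by
    intro n hdn hln
    have h1 : I / 2 < ∫ x, min (hn n x) (k : ℝ) ∂ν := by
      have : ∫ x, (min (h x) (k : ℝ) - (h x - hn n x)) ∂ν ≤ ∫ x, min (hn n x) (k : ℝ) ∂ν := by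
        refine integral_mono_ae ((hminint h k hhint').sub (hhint'.sub (hnint' n)))
          (hminint _ k (hnint' n)) ?_
        filter_upwards [hle n] with x hx
        refine le_min ?_ ?_
        · linarith [min_le_left (h x) (k : ℝ)]
        · linarith [min_le_right (h x) (k : ℝ)]
      have hsub : Integrable (fun x => h x - hn n x) ν := hhint'.sub (hnint' n)
      rw [integral_sub (hminint h k hhint') hsub] at this
      have e : ∫ x, (h x - hn n x) ∂ν = d n := rfl
      linarith
    have hS : NullMeasurableSet {x | lam n ≤ hn n x} ν :=
      nullMeasurableSet_le aemeasurable_const (hnint' n).aemeasurable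
    have hsplit := integral_add_compl₀ hS (hminint _ k (hnint' n))
    have hc : {x | lam n ≤ hn n x}ᶜ = {x | hn n x < lam n} := by
      ext x; simp
    rw [hc] at hsplit
    have hA : ∫ x in {x | lam n ≤ hn n x}, min (hn n x) (k : ℝ) ∂ν
        ≤ k * (volume {x ∈ Ioo a b | lam n ≤ hn n x}).toReal := by
      have e : volume {x ∈ Ioo a b | lam n ≤ hn n x} = ν {x | lam n ≤ hn n x} := by
        rw [hν, Measure.restrict_apply' measurableSet_Ioo, inter_comm]; rfl
      rw [e]
      calc _ ≤ ∫ x in {x | lam n ≤ hn n x}, (k : ℝ) ∂ν :=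
            integral_mono (hminint _ k (hnint' n)).integrableOn (integrable_const _)
              (fun x => min_le_right _ _)
        _ = _ := by simp [Measure.real, mul_comm]
    have hB : ∫ x in {x | hn n x < lam n}, min (hn n x) (k : ℝ) ∂ν
        ≤ ∫ x in {x ∈ Ioo a b | hn n x < lam n}, hn n x := by
      have e : volume.restrict {x ∈ Ioo a b | hn n x < lam n}
          = ν.restrict {x | hn n x < lam n} := by
        rw [hν, Measure.restrict_restrict' measurableSet_Ioo, inter_comm]; rfl
      rw [e]
      exact integral_mono (hminint _ k (hnint' n)).integrableOn (hnint' n).integrableOn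
              (fun x => min_le_left _ _)
    have hJ : 0 ≤ ∫ x in {x ∈ Ioo a b | hn n x < lam n}, hn n x := by
      have e : volume.restrict {x ∈ Ioo a b | hn n x < lam n}
          = ν.restrict {x | hn n x < lam n} := by
        rw [hν, Measure.restrict_restrict' measurableSet_Ioo, inter_comm]; rfl
      rw [e]
      exact integral_nonneg_of_ae (ae_restrict_of_ae (hn0 n))
    rw [div_lt_iff₀ hkpos, hmuf n]
    have h2 : (1 : ℝ) ≤ 1 / lam n * k := by
      rw [div_mul_eq_mul_div, le_div_iff₀ (hlampos n)]; linarith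
    have h3 := mul_le_mul_of_nonneg_right h2 hJ
    nlinarith
  have hev : ∀ᶠ n in atTop, I / 2 / k < muf n := by
    filter_upwards [hd0.eventually (gt_mem_nhds (show 0 < I / 4 by linarith)),
      hlam0.eventually (gt_mem_nhds one_pos)] with n h1 h2 using key n h1 h2
  have hm : 0 < I / 2 / k := by positivity
  have heps' : ∀ n, eps n = d n / muf n := heps
  have hdpos : ∀ n, 0 < d n := hdiff
  refine ⟨?_, ?_, ?_⟩
  · obtain ⟨N, hN⟩ := eventually_atTop.1 hev
    exact ⟨_, hm, N, hN⟩
  · have ht := hd0.div_const (I / 2 / k)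
    rw [zero_div] at ht
    refine tendsto_of_tendsto_of_tendsto_of_le_of_le' tendsto_const_nhds ht ?_ ?_
    · filter_upwards [hev] with n h1
      rw [heps' n]
      exact div_nonneg (hdpos n).le (hm.trans h1).le
    · filter_upwards [hev] with n h1
      rw [heps' n]
      exact div_le_div_of_nonneg_left (hdpos n).le hm h1.le
  · have ht := (hd0.rpow_const (p := 1 - r) (Or.inr (by linarith))).div_const (I / 2 / k)
    rw [Real.zero_rpow (by linarith), zero_div] at ht
    have e : ∀ n, eps n / lam n = d n ^ (1 - r) / muf n := by
      intro n
      have : lam n = d n ^ r := hlam n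
      rw [heps' n, this, Real.rpow_sub (hdpos n), Real.rpow_one, div_right_comm]
    refine tendsto_of_tendsto_of_tendsto_of_le_of_le' tendsto_const_nhds ht ?_ ?_
    · filter_upwards [hev] with n h1
      rw [e n]
      exact div_nonneg (Real.rpow_pos_of_pos (hdpos n) _).le (hm.trans h1).le
    · filter_upwards [hev] with n h1
      rw [e n]
      exact div_le_div_of_nonneg_left (Real.rpow_pos_of_pos (hdpos n) _).le hm h1.le
end

section
/- Let a < b, let h : (a,b) → [0,∞) be integrable with ∫_a^b h dx > 0, and let f_n : [a,b] → [0,∞) be Lipschitz functions with 0 ≤ f_n ≤ h a.e., f_n → h in L¹((a,b)), and ∫_a^b (h − f_n) dx > 0 for every n. Fix r ∈ (0,1), set λ_n := (∫_a^b (h − f_n) dx)^r, μ_n := |{f_n ≥ λ_n}| + (1/λ_n)∫_{{f_n < λ_n}} f_n dx, ε_n := (∫_a^b (h − f_n) dx)/μ_n, and g_n := min{f_n + ε_n, (1 + ε_n/λ_n) f_n}. Then for all sufficiently large n: g_n is well defined and Lipschitz continuous, f_n ≤ g_n ≤ f_n + ε_n pointwise, ∫_a^b g_n dx = ∫_a^b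 h dx, and g_n → h in L¹((a,b)). -/
open MeasureTheory Filter Set

lemma aux_pt {t e l : ℝ} (he : 0 ≤ e) (hl : 0 < l) (ht : 0 ≤ t) :
    min (t + e) ((1 + e / l) * t) = t + e * min 1 (t / l) := by
  rw [mul_min_of_nonneg _ _ he, mul_one, ← min_add_add_left]
  congr 1
  field_simp

lemma aux_nonneg {a b : ℝ} (hab : a < b) {f : ℝ → ℝ} (hc : ContinuousOn f (Icc a b))
    (h0 : ∀ᵐ x ∂(volume.restrict (Ioo a b)), 0 ≤ f x) : ∀ x ∈ Icc a b, 0 ≤ f x := by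
  have h1 : f =ᵐ[volume.restrict (Icc a b)] fun x => |f x| := by
    rw [← Measure.restrict_congr_set (Ioo_ae_eq_Icc (a := a) (b := b))]
    filter_upwards [h0] with x hx
    exact (abs_of_nonneg hx).symm
  have h2 := Measure.eqOn_Icc_of_ae_eq volume hab.ne h1 hc hc.abs
  intro x hx
  rw [h2 hx]
  exact abs_nonneg _

lemma aux_mu {a b : ℝ} {f : ℝ → ℝ} {l : ℝ} (hl : 0 < l) (hc : ContinuousOn f (Icc a b)) :
    IntegrableOn (fun x => min 1 (f x / l)) (Ioo a b) ∧
    (volume {x ∈ Ioo a b | l ≤ f x}).toReal + (1 / l) * ∫ x in {x ∈ Ioo a b | f x < l}, f x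
      = ∫ x in Ioo a b, min 1 (f x / l) := by
  have hi : IntegrableOn (fun x => min 1 (f x / l)) (Ioo a b) := by
    have : ContinuousOn (fun x => min 1 (f x / l)) (Icc a b) :=
      continuousOn_const.inf (hc.div_const l)
    exact (this.integrableOn_compact isCompact_Icc).mono_set Ioo_subset_Icc_self
  refine ⟨hi, ?_⟩
  have hB : MeasurableSet {x ∈ Ioo a b | f x < l} :=
    ((hc.mono Ioo_subset_Icc_self).isOpen_inter_preimage isOpen_Ioo
      (isOpen_Iio (a := l))).measurableSet
  have hAe : {x ∈ Ioo a b | l ≤ f x} = Ioo a b \ {x ∈ Ioo a b | f x < l} := by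
    ext x
    simp only [mem_setOf_eq, mem_diff, not_and, not_lt]
    tauto
  have hA : MeasurableSet {x ∈ Ioo a b | l ≤ f x} := by
    rw [hAe]; exact measurableSet_Ioo.diff hB
  have hU : Ioo a b = {x ∈ Ioo a b | l ≤ f x} ∪ {x ∈ Ioo a b | f x < l} := by
    rw [hAe, diff_union_of_subset (sep_subset _ _)]
  have hd : Disjoint {x ∈ Ioo a b | l ≤ f x} {x ∈ Ioo a b | f x < l} := by
    rw [hAe]; exact disjoint_sdiff_left
  have key : ∫ x in Ioo a b, min 1 (f x / l) = (∫ x in {x ∈ Ioo a b | l ≤ f x}, min 1 (f x / l))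
      + ∫ x in {x ∈ Ioo a b | f x < l}, min 1 (f x / l) := by
    rw [← setIntegral_union hd hB (hi.mono_set (sep_subset _ _)) (hi.mono_set (sep_subset _ _)),
      ← hU]
  rw [key]
  congr 1
  · rw [setIntegral_congr_fun (g := fun _ => (1 : ℝ)) hA]
    · simp [Measure.real]
    · intro x hx
      exact min_eq_left ((one_le_div hl).2 hx.2)
  · rw [← integral_const_mul]
    refine setIntegral_congr_fun hB ?_
    intro x hx
    have : f x / l ≤ 1 := (div_le_one hl).2 hx.2.le
    simp only [min_eq_right this]
    ring

/-- The modified Lipschitz profiles `g_n := min{f_n + ε_n, (1 + ε_n/λ_n) f_n}` are, for `n`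
large, well defined (`μ_n > 0`), Lipschitz, satisfy `f_n ≤ g_n ≤ f_n + ε_n`, enclose exactly
the volume `∫ h`, and converge to `h` in `L¹((a,b))`. -/
theorem stmt_4 (a b : ℝ) (hab : a < b)
    (h : ℝ → ℝ) (hhint : IntegrableOn h (Ioo a b))
    (hhnonneg : ∀ x ∈ Ioo a b, 0 ≤ h x)
    (hpos : 0 < ∫ x in Ioo a b, h x)
    (f : ℕ → ℝ → ℝ)
    (hflip : ∀ n, ∃ C : NNReal, LipschitzOnWith C (f n) (Icc a b))
    (hf0 : ∀ n, ∀ᵐ x ∂(volume.restrict (Ioo a b)), 0 ≤ f n x ∧ f n x ≤ h x)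
    (hL1 : Tendsto (fun n => ∫ x in Ioo a b, |f n x - h x|) atTop (nhds 0))
    (hdiff : ∀ n, 0 < ∫ x in Ioo a b, (h x - f n x))
    (r : ℝ) (hr : r ∈ Ioo (0 : ℝ) 1)
    (lam muf eps : ℕ → ℝ) (g : ℕ → ℝ → ℝ)
    (hlam : ∀ n, lam n = (∫ x in Ioo a b, (h x - f n x)) ^ r)
    (hmuf : ∀ n, muf n = (volume {x ∈ Ioo a b | lam n ≤ f n x}).toReal
        + (1 / lam n) * ∫ x in {x ∈ Ioo a b | f n x < lam n}, f n x)
    (heps : ∀ n, eps n = (∫ x in Ioo a b, (h x - f n x)) / muf n)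
    (hg : ∀ n x, g n x = min (f n x + eps n) ((1 + eps n / lam n) * f n x)) :
    (∃ N : ℕ, ∀ n ≥ N,
        0 < muf n
        ∧ (∃ C : NNReal, LipschitzOnWith C (g n) (Icc a b))
        ∧ (∀ x ∈ Icc a b, f n x ≤ g n x ∧ g n x ≤ f n x + eps n)
        ∧ (∫ x in Ioo a b, g n x) = ∫ x in Ioo a b, h x)
      ∧ Tendsto (fun n => ∫ x in Ioo a b, |g n x - h x|) atTop (nhds 0) := by
  have hc : ∀ n, ContinuousOn (f n) (Icc a b) := fun n => (hflip n).choose_spec.continuousOn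
  have hfn : ∀ n, ∀ x ∈ Icc a b, 0 ≤ f n x := fun n =>
    aux_nonneg hab (hc n) ((hf0 n).mono fun x hx => hx.1)
  have hfi : ∀ n, IntegrableOn (f n) (Ioo a b) := fun n =>
    ((hc n).integrableOn_compact isCompact_Icc).mono_set Ioo_subset_Icc_self
  have hl : ∀ n, 0 < lam n := fun n => by
    rw [hlam]; exact Real.rpow_pos_of_pos (hdiff n) _
  have hmu : ∀ n, muf n = ∫ x in Ioo a b, min 1 (f n x / lam n) := fun n => by
    rw [hmuf]; exact (aux_mu (hl n) (hc n)).2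
  have hsub : ∀ n, ∫ x in Ioo a b, (h x - f n x)
      = (∫ x in Ioo a b, h x) - ∫ x in Ioo a b, f n x := fun n =>
    integral_sub hhint (hfi n)
  have habs : ∀ n, ∫ x in Ioo a b, |f n x - h x| = ∫ x in Ioo a b, (h x - f n x) := fun n => by
    refine integral_congr_ae ?_
    filter_upwards [hf0 n] with x hx
    rw [abs_sub_comm, abs_of_nonneg (sub_nonneg.2 hx.2)]
  have hphi0 : ∀ n, ∀ x ∈ Icc a b, 0 ≤ min 1 (f n x / lam n) := fun n x hx =>
    le_min zero_le_one (div_nonneg (hfn n x hx) (hl n).le)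
  have hmupos : ∀ᶠ n in atTop, 0 < muf n := by
    filter_upwards [hL1.eventually (gt_mem_nhds hpos)] with n hn
    rw [habs, hsub] at hn
    have hfpos : 0 < ∫ x in Ioo a b, f n x := by linarith
    rw [hmu]
    have hnn : 0 ≤ᵐ[volume.restrict (Ioo a b)] fun x => min 1 (f n x / lam n) := by
      filter_upwards [ae_restrict_mem measurableSet_Ioo] with x hx
      exact hphi0 n x (Ioo_subset_Icc_self hx)
    refine lt_of_le_of_ne (integral_nonneg_of_ae hnn) fun h0 => ?_
    have hz := (integral_eq_zero_iff_of_nonneg_ae hnn (aux_mu (hl n) (hc n)).1).1 h0.symm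
    have : ∫ x in Ioo a b, f n x = 0 := by
      refine integral_eq_zero_of_ae ?_
      filter_upwards [hz] with x hx
      simp only [Pi.zero_apply] at hx ⊢
      rcases min_choice 1 (f n x / lam n) with h1 | h1
      · rw [h1] at hx; norm_num at hx
      · rw [h1, div_eq_zero_iff] at hx
        exact hx.resolve_right (hl n).ne'
    linarith
  have hepos : ∀ n, 0 < muf n → 0 ≤ eps n := fun n hn => by
    rw [heps]; exact div_nonneg (hdiff n).le hn.le
  have hgf : ∀ n, 0 < muf n → ∀ x ∈ Icc a b,
      g n x = f n x + eps n * min 1 (f n x / lam n) := fun n hn x hx => by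
    rw [hg, aux_pt (hepos n hn) (hl n) (hfn n x hx)]
  have hem : ∀ n, 0 < muf n →
      ∫ x in Ioo a b, eps n * min 1 (f n x / lam n) = ∫ x in Ioo a b, (h x - f n x) :=
    fun n hn => by
      rw [integral_const_mul, ← hmu, heps, div_mul_cancel₀ _ hn.ne']
  have hphi : ∀ n, IntegrableOn (fun x => eps n * min 1 (f n x / lam n)) (Ioo a b) := fun n =>
    (aux_mu (hl n) (hc n)).1.const_mul _
  refine ⟨?_, ?_⟩
  · obtain ⟨N, hN⟩ := eventually_atTop.1 hmupos
    refine ⟨N, fun n hn => ?_⟩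
    have hm := hN n hn
    have he := hepos n hm
    refine ⟨hm, ?_, ?_, ?_⟩
    · obtain ⟨C, hC⟩ := hflip n
      have hq : 0 ≤ eps n / lam n := div_nonneg he (hl n).le
      refine ⟨(1 + (eps n / lam n).toNNReal) * C, LipschitzOnWith.of_dist_le_mul ?_⟩
      intro x hx y hy
      have h1 := hC.dist_le_mul x hx y hy
      rw [Real.dist_eq] at h1 ⊢
      rw [hg, hg]
      refine (abs_min_sub_min_le_max _ _ _ _).trans (max_le ?_ ?_)
      · rw [add_sub_add_right_eq_sub]
        push_cast
        rw [Real.coe_toNNReal _ hq, mul_assoc]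
        have : 0 ≤ (eps n / lam n) * (C * dist x y) := by positivity
        linarith
      · rw [← mul_sub, abs_mul, abs_of_nonneg (by linarith : 0 ≤ 1 + eps n / lam n)]
        push_cast
        rw [Real.coe_toNNReal _ hq, mul_assoc]
        exact mul_le_mul_of_nonneg_left h1 (by linarith)
    · intro x hx
      refine ⟨?_, ?_⟩
      · rw [hgf n hm x hx]
        have := mul_nonneg he (hphi0 n x hx)
        linarith
      · rw [hg]; exact min_le_left _ _
    · rw [setIntegral_congr_fun measurableSet_Ioo
        (fun x hx => hgf n hm x (Ioo_subset_Icc_self hx)), integral_add (hfi n) (hphi n),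
        hem n hm, hsub]
      ring
  · have h2 : Tendsto (fun n => 2 * ∫ x in Ioo a b, |f n x - h x|) atTop (nhds 0) := by
      simpa using hL1.const_mul 2
    refine tendsto_of_tendsto_of_tendsto_of_le_of_le' tendsto_const_nhds h2
      (Eventually.of_forall fun n => integral_nonneg fun x => abs_nonneg _) ?_
    filter_upwards [hmupos] with n hm
    have he := hepos n hm
    have hdi : IntegrableOn (fun x => |f n x - h x|) (Ioo a b) := ((hfi n).sub hhint).abs
    have : ∫ x in Ioo a b, |g n x - h x|
        ≤ ∫ x in Ioo a b, (eps n * min 1 (f n x / lam n) + |f n x - h x|) := by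
      refine integral_mono_of_nonneg (Eventually.of_forall fun x => abs_nonneg _)
        ((hphi n).add hdi) ?_
      filter_upwards [ae_restrict_mem measurableSet_Ioo] with x hx
      have hx' := Ioo_subset_Icc_self hx
      have h0 := mul_nonneg he (hphi0 n x hx')
      rw [hgf n hm x hx']
      calc _ = |eps n * min 1 (f n x / lam n) + (f n x - h x)| := by congr 1; ring
        _ ≤ _ := by
          refine (abs_add_le _ _).trans ?_
          rw [abs_of_nonneg h0]
    rw [integral_add (hphi n) hdi, hem n hm, ← habs] at this
    linarith
end

section
/- Let f : [a,b] → [0,∞) be Lipschitz continuous, let ε ≥ 0 and λ > 0, define g := min{f + ε, (1 + ε/λ) f} pointwise, and set σ := (ε/λ)² + 2ε/λ. Then, with f′ and g′ denoting the almost-everywhere defined derivatives of f and g, one has 0 ≤ ∫_a^b √(1 + g′(x)²) dx − ∫_a^b √(1 + f′(x)²) dx ≤ (σ/2) ∫_a^b √(1 + g′(x)²) dx. -/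
open MeasureTheory Filter Set

lemma aux_phi (k e s t : ℝ) (hk : 1 ≤ k) :
    |s - t| ≤ |min (s + e) (k * s) - min (t + e) (k * t)| ∧
    |min (s + e) (k * s) - min (t + e) (k * t)| ≤ k * |s - t| := by
  wlog h : t ≤ s generalizing s t
  · have := this t s (le_of_not_ge h)
    rwa [abs_sub_comm s t, abs_sub_comm (min (s + e) (k * s))]
  have h0 : 0 ≤ s - t := by linarith
  have h1 : s - t ≤ k * (s - t) := by nlinarith
  have h2 : s - t ≤ min (s + e) (k * s) - min (t + e) (k * t) := by
    rcases min_cases (s + e) (k * s) with h3 | h3 <;>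
    rcases min_cases (t + e) (k * t) with h4 | h4 <;> linarith
  have h5 : min (s + e) (k * s) - min (t + e) (k * t) ≤ k * (s - t) := by
    rcases min_cases (s + e) (k * s) with h3 | h3 <;>
    rcases min_cases (t + e) (k * t) with h4 | h4 <;> linarith
  rw [abs_of_nonneg h0, abs_of_nonneg (h0.trans h2)]
  exact ⟨h2, h5⟩

lemma aux_deriv (f g : ℝ → ℝ) (k x : ℝ) (hf : DifferentiableAt ℝ f x)
    (hg : DifferentiableAt ℝ g x) (h : ∀ y, |f y - f x| ≤ k * |g y - g x|) :
    |deriv f x| ≤ k * |deriv g x| := by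
  have h1 := (hasDerivAt_iff_tendsto_slope.1 hf.hasDerivAt).abs
  have h2 := (hasDerivAt_iff_tendsto_slope.1 hg.hasDerivAt).abs.const_mul k
  refine le_of_tendsto_of_tendsto' h1 h2 fun y => ?_
  simp only [slope_def_field, abs_div]
  rw [← mul_div_assoc]
  exact div_le_div_of_nonneg_right (h y) (abs_nonneg _)

lemma aux_diff (f : ℝ → ℝ) (a b : ℝ) (C : NNReal) (h : LipschitzOnWith C f (Icc a b)) :
    ∀ᵐ x ∂(volume.restrict (Ioo a b)), DifferentiableAt ℝ f x := by
  rw [ae_restrict_iff' measurableSet_Ioo]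
  filter_upwards [h.ae_differentiableWithinAt_of_mem_real] with x hx hx'
  exact (hx (Ioo_subset_Icc_self hx')).differentiableAt (Icc_mem_nhds hx'.1 hx'.2)

lemma aux_int (f : ℝ → ℝ) (a b : ℝ) (C : NNReal) (h : LipschitzOnWith C f (Icc a b)) :
    Integrable (fun x => Real.sqrt (1 + deriv f x ^ 2)) (volume.restrict (Ioo a b)) := by
  have hfin : IsFiniteMeasure (volume.restrict (Ioo a b)) := by
    constructor; simp
  refine Integrable.of_bound (C := Real.sqrt (1 + (C:ℝ) ^ 2)) ?_ ?_
  · have := measurable_deriv f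
    exact (by fun_prop : Measurable fun x => Real.sqrt (1 + deriv f x ^ 2)).aestronglyMeasurable
  · rw [ae_restrict_iff' measurableSet_Ioo]
    refine Eventually.of_forall fun x hx => ?_
    rw [Real.norm_of_nonneg (Real.sqrt_nonneg _)]
    have := norm_deriv_le_of_lipschitzOn (Icc_mem_nhds hx.1 hx.2) h
    rw [Real.norm_eq_abs] at this
    exact Real.sqrt_le_sqrt (by have := sq_le_sq' (by linarith [abs_nonneg (deriv f x), neg_abs_le (deriv f x)]) ((le_abs_self _).trans this); linarith)


/-- Arclength comparison for the modified profile `g := min{f + ε, (1 + ε/λ) f}` of a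
Lipschitz `f : [a,b] → [0,∞)`, with `σ := (ε/λ)² + 2ε/λ`:
`0 ≤ ∫√(1+g′²) − ∫√(1+f′²) ≤ (σ/2) ∫√(1+g′²)`. -/
theorem stmt_5 (a b : ℝ) (hab : a ≤ b)
    (f : ℝ → ℝ) (hnonneg : ∀ x ∈ Icc a b, 0 ≤ f x)
    (C : NNReal) (hlip : LipschitzOnWith C f (Icc a b))
    (ε lam : ℝ) (hε : 0 ≤ ε) (hlam : 0 < lam)
    (g : ℝ → ℝ) (hg : ∀ x, g x = min (f x + ε) ((1 + ε / lam) * f x))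
    (σ : ℝ) (hσ : σ = (ε / lam) ^ 2 + 2 * (ε / lam)) :
    0 ≤ (∫ x in Ioo a b, Real.sqrt (1 + deriv g x ^ 2))
        - (∫ x in Ioo a b, Real.sqrt (1 + deriv f x ^ 2))
      ∧ (∫ x in Ioo a b, Real.sqrt (1 + deriv g x ^ 2))
          - (∫ x in Ioo a b, Real.sqrt (1 + deriv f x ^ 2))
        ≤ (σ / 2) * ∫ x in Ioo a b, Real.sqrt (1 + deriv g x ^ 2) := by
  have hr : 0 ≤ ε / lam := by positivity
  set k := 1 + ε / lam with hk
  have hk1 : 1 ≤ k := by linarith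
  have hphi : ∀ x y, |f x - f y| ≤ |g x - g y| ∧ |g x - g y| ≤ k * |f x - f y| := by
    intro x y
    rw [hg x, hg y]
    exact aux_phi k ε (f x) (f y) hk1
  have hglip : LipschitzOnWith (k.toNNReal * C) g (Icc a b) := by
    apply LipschitzOnWith.of_dist_le_mul
    intro x hx y hy
    have h1 := hlip.dist_le_mul x hx y hy
    rw [Real.dist_eq] at h1 ⊢
    push_cast
    rw [Real.coe_toNNReal k (by linarith), mul_assoc]
    exact (hphi x y).2.trans (mul_le_mul_of_nonneg_left h1 (by linarith))
  have hif := aux_int f a b C hlip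
  have hig := aux_int g a b _ hglip
  have hσ' : σ = k ^ 2 - 1 := by rw [hσ, hk]; ring
  have hσ0 : 0 ≤ σ := by rw [hσ]; positivity
  have key : ∀ᵐ x ∂(volume.restrict (Ioo a b)),
      Real.sqrt (1 + deriv f x ^ 2) ≤ Real.sqrt (1 + deriv g x ^ 2) ∧
      Real.sqrt (1 + deriv g x ^ 2) - Real.sqrt (1 + deriv f x ^ 2)
        ≤ (σ / 2) * Real.sqrt (1 + deriv g x ^ 2) := by
    filter_upwards [aux_diff f a b C hlip, aux_diff g a b _ hglip] with x hfx hgx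
    have h1 := aux_deriv f g 1 x hfx hgx (fun y => by rw [one_mul]; exact (hphi y x).1)
    have h2 := aux_deriv g f k x hgx hfx (fun y => (hphi y x).2)
    rw [one_mul] at h1
    have h3 : deriv f x ^ 2 ≤ deriv g x ^ 2 := sq_le_sq.2 h1
    have h4 : deriv g x ^ 2 ≤ k ^ 2 * deriv f x ^ 2 := by
      have := pow_le_pow_left₀ (abs_nonneg _) h2 2
      rwa [mul_pow, sq_abs, sq_abs] at this
    have hFG : Real.sqrt (1 + deriv f x ^ 2) ≤ Real.sqrt (1 + deriv g x ^ 2) :=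
      Real.sqrt_le_sqrt (by linarith)
    refine ⟨hFG, ?_⟩
    have hF2 := Real.sq_sqrt (show 0 ≤ 1 + deriv f x ^ 2 by positivity)
    have hG2 := Real.sq_sqrt (show 0 ≤ 1 + deriv g x ^ 2 by positivity)
    have hF : 0 < Real.sqrt (1 + deriv f x ^ 2) := Real.sqrt_pos.2 (by positivity)
    set F := Real.sqrt (1 + deriv f x ^ 2)
    set G := Real.sqrt (1 + deriv g x ^ 2)
    have h5 : (G - F) * (G + F) ≤ σ * F ^ 2 := by
      have : (G - F) * (G + F) = G ^ 2 - F ^ 2 := by ring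
      rw [this, hF2, hG2, hσ']
      nlinarith
    have h6 : σ * F ^ 2 ≤ (σ / 2 * G) * (G + F) := by
      have : 2 * F ^ 2 ≤ G * (G + F) := by nlinarith
      nlinarith
    exact le_of_mul_le_mul_right (h5.trans h6) (by linarith)
  constructor
  · rw [sub_nonneg]
    exact integral_mono_ae hif hig (key.mono fun x hx => hx.1)
  · rw [← integral_sub hig hif, ← integral_const_mul]
    exact integral_mono_ae (hig.sub hif) (hig.const_mul _) (key.mono fun x hx => hx.2)
end

section
/- Let a < b and let h : [a,b] → [0,∞) be lower semicontinuous with finite pointwise variation. Define Ω_h := {(x,y) ∈ ℝ² : a < x < b, y < h(x)} and h⁻(x) := liminf_{z → x} h(z). Then h⁻ is lower semicontinuous, and the interior of the closure of Ω_h equals {(x,y) ∈ ℝ² : a < x < b, y < h⁻(x)}. -/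
open MeasureTheory Filter Set

/-- For a lower semicontinuous `h : [a,b] → [0,∞)` of finite pointwise variation, the
function `h⁻(x) := liminf_{z→x} h(z)` is lower semicontinuous and the interior of the
closure of the subgraph `Ω_h` is the strict subgraph of `h⁻`. -/
theorem stmt_9 (a b : ℝ) (hab : a < b)
    (h : ℝ → ℝ) (hnonneg : ∀ x ∈ Icc a b, 0 ≤ h x)
    (hlsc : LowerSemicontinuousOn h (Icc a b))
    (hbv : BoundedVariationOn h (Icc a b))
    (Ω : Set (ℝ × ℝ)) (hΩ : Ω = {p : ℝ × ℝ | a < p.1 ∧ p.1 < b ∧ p.2 < h p.1})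
    (hm : ℝ → ℝ)
    (hhm : ∀ x, hm x = Filter.liminf h (nhdsWithin x (Icc a b \ {x}))) :
    LowerSemicontinuousOn hm (Icc a b)
      ∧ interior (closure Ω) = {p : ℝ × ℝ | a < p.1 ∧ p.1 < b ∧ p.2 < hm p.1} := by
  have neb : ∀ x ∈ Icc a b, (nhdsWithin x (Icc a b \ {x})).NeBot := by
    intro x hx
    rw [← mem_closure_iff_nhdsWithin_neBot, Metric.mem_closure_iff]
    intro ε hε
    rcases lt_or_eq_of_le hx.2 with hxb | hxb
    · have h1 : x < min b (x + ε / 2) := lt_min hxb (by linarith)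
      refine ⟨min b (x + ε / 2), ⟨⟨hx.1.trans h1.le, min_le_left _ _⟩, h1.ne'⟩, ?_⟩
      rw [dist_comm, Real.dist_eq, abs_of_pos (by linarith)]
      have := min_le_right b (x + ε / 2)
      linarith
    · have h1 : max a (x - ε / 2) < x := max_lt (by linarith) (by linarith)
      refine ⟨max a (x - ε / 2), ⟨⟨le_max_left _ _, h1.le.trans hx.2⟩, h1.ne⟩, ?_⟩
      rw [Real.dist_eq, abs_of_pos (by linarith)]
      have := le_max_right a (x - ε / 2)
      linarith
  have hmem : ∀ x (P : ℝ → Prop), (∀ᶠ z in nhdsWithin x (Icc a b \ {x}), P z) ↔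
      ∃ ε > 0, ∀ z ∈ Icc a b, z ≠ x → |z - x| < ε → P z := by
    intro x P
    rw [Metric.nhdsWithin_basis_ball.eventually_iff]
    constructor
    · rintro ⟨ε, hε, H⟩
      exact ⟨ε, hε, fun z hz hzx hd => H ⟨by simpa [Real.dist_eq] using hd, hz, hzx⟩⟩
    · rintro ⟨ε, hε, H⟩
      exact ⟨ε, hε, fun z hz => H z hz.2.1 hz.2.2 (by simpa [Real.dist_eq] using hz.1)⟩
  have K1 : ∀ x y, y < hm x → ∃ c > y, ∃ ε > 0, ∀ z ∈ Icc a b, z ≠ x → |z - x| < ε → c < h z := by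
    intro x y hy
    obtain ⟨c, hc1, hc2⟩ := exists_between hy
    refine ⟨c, hc1, ?_⟩
    rw [← hmem]
    rw [hhm] at hc2
    refine eventually_lt_of_lt_liminf hc2 ⟨0, ?_⟩
    rw [eventually_map]
    exact (hmem _ _).2 ⟨1, one_pos, fun z hz _ _ => hnonneg z hz⟩
  have K2 : ∀ x ∈ Icc a b, ∀ c ε, 0 < ε → (∀ z ∈ Icc a b, z ≠ x → |z - x| < ε → c ≤ h z) →
      c ≤ hm x := by
    intro x hx c ε hε H
    have := neb x hx
    rw [hhm]
    refine le_liminf_of_le ?_ ((hmem _ _).2 ⟨ε, hε, H⟩)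
    apply IsBoundedUnder.isCoboundedUnder_ge
    refine ⟨h a + (eVariationOn h (Icc a b)).toReal, ?_⟩
    rw [eventually_map]
    refine (hmem _ _).2 ⟨1, one_pos, fun z hz _ _ => ?_⟩
    have := hbv.sub_le hz (left_mem_Icc.2 hab.le)
    linarith
  refine ⟨?_, ?_⟩
  · intro x hx y hy
    obtain ⟨c, hc, ε, hε, H⟩ := K1 x y hy
    have : ∀ᶠ z in nhdsWithin x (Icc a b), z ∈ Metric.ball x ε ∧ z ∈ Icc a b :=
      Filter.inter_mem (mem_nhdsWithin_of_mem_nhds (Metric.ball_mem_nhds x hε)) self_mem_nhdsWithin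
    filter_upwards [this] with z hz
    by_cases hzx : z = x
    · rw [hzx]; exact hy
    have hd : |z - x| < ε := by simpa [Real.dist_eq] using hz.1
    refine hc.trans_le (K2 z hz.2 c (min |z - x| (ε - |z - x|))
      (lt_min (abs_pos.2 (sub_ne_zero.2 hzx)) (by linarith)) ?_)
    intro w hw hwz hwd
    have h1 := hwd.trans_le (min_le_left _ _)
    have h2 := hwd.trans_le (min_le_right _ _)
    refine (H w hw ?_ ?_).le
    · rintro rfl
      rw [abs_sub_comm] at h1
      exact lt_irrefl _ h1
    · have := abs_sub_le w z x
      linarith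
  have key : ∀ V : Set ℝ, IsOpen V → ∀ y₂, (∀ z ∈ V, a < z → z < b → h z < y₂) →
      ∀ z ∈ V, ∀ y' > y₂, (z, y') ∉ closure Ω := by
    intro V hV y₂ H z hz y' hy' hcl
    rw [mem_closure_iff] at hcl
    obtain ⟨p, hp1, hp2⟩ := hcl (V ×ˢ Ioi y₂) (hV.prod isOpen_Ioi) ⟨hz, hy'⟩
    rw [hΩ] at hp2
    have := H p.1 hp1.1 hp2.1 hp2.2.1
    have h3 : y₂ < p.2 := hp1.2
    have h4 := hp2.2.2
    linarith
  have hclI : ∀ p ∈ closure Ω, a ≤ p.1 ∧ p.1 ≤ b := by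
    have hc : IsClosed {p : ℝ × ℝ | a ≤ p.1 ∧ p.1 ≤ b} :=
      (isClosed_le continuous_const continuous_fst).inter
        (isClosed_le continuous_fst continuous_const)
    refine fun p hp => closure_minimal ?_ hc hp
    rw [hΩ]
    exact fun q hq => ⟨hq.1.le, hq.2.1.le⟩
  apply Subset.antisymm
  · rintro ⟨x, y⟩ hp
    rw [mem_interior_iff_mem_nhds, Metric.mem_nhds_iff] at hp
    obtain ⟨ε, hε, hball⟩ := hp
    have hB : ∀ z w, |z - x| < ε → |w - y| < ε → (z, w) ∈ closure Ω := by
      intro z w hz hw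
      apply hball
      rw [Metric.mem_ball, Prod.dist_eq]
      exact max_lt (by simpa [Real.dist_eq] using hz) (by simpa [Real.dist_eq] using hw)
    have hax : a < x := by
      have := (hclI _ (hB (x - ε / 2) y (by rw [abs_lt]; constructor <;> linarith)
        (by simpa using hε))).1
      simp only at this
      linarith
    have hxb : x < b := by
      have := (hclI _ (hB (x + ε / 2) y (by rw [abs_lt]; constructor <;> linarith)
        (by simpa using hε))).2
      simp only at this
      linarith
    refine ⟨hax, hxb, ?_⟩
    show y < hm x
    obtain ⟨l, hl⟩ := hbv.exists_tendsto_left x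
    obtain ⟨r, hr⟩ := hbv.exists_tendsto_right x
    have hy' : |y + ε / 2 - y| < ε := by rw [abs_lt]; constructor <;> linarith
    have hl1 : y + ε / 8 < l := by
      by_contra hcon
      have : ∀ᶠ z in nhdsWithin x (Icc a b ∩ Iio x), h z < y + ε / 4 :=
        hl.eventually (gt_mem_nhds (by linarith))
      rw [Metric.nhdsWithin_basis_ball.eventually_iff] at this
      obtain ⟨δ, hδ, H⟩ := this
      have hm1 := min_le_left δ ε
      have hm2 := min_le_right δ ε
      have hm3 := lt_min hδ hε
      refine key (Ioo (x - δ) x) isOpen_Ioo (y + ε / 4) ?_ (x - min δ ε / 2)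
        ⟨by linarith, by linarith⟩ (y + ε / 2) (by linarith)
        (hB _ _ (by rw [abs_lt]; constructor <;> linarith) hy')
      intro z hz h1 h2
      exact H ⟨by rw [Metric.mem_ball, Real.dist_eq, abs_lt]; constructor <;> linarith [hz.1, hz.2],
        ⟨h1.le, h2.le⟩, hz.2⟩
    have hr1 : y + ε / 8 < r := by
      by_contra hcon
      have : ∀ᶠ z in nhdsWithin x (Icc a b ∩ Ioi x), h z < y + ε / 4 :=
        hr.eventually (gt_mem_nhds (by linarith))
      rw [Metric.nhdsWithin_basis_ball.eventually_iff] at this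
      obtain ⟨δ, hδ, H⟩ := this
      have hm1 := min_le_left δ ε
      have hm2 := min_le_right δ ε
      have hm3 := lt_min hδ hε
      refine key (Ioo x (x + δ)) isOpen_Ioo (y + ε / 4) ?_ (x + min δ ε / 2)
        ⟨by linarith, by linarith⟩ (y + ε / 2) (by linarith)
        (hB _ _ (by rw [abs_lt]; constructor <;> linarith) hy')
      intro z hz h1 h2
      exact H ⟨by rw [Metric.mem_ball, Real.dist_eq, abs_lt]; constructor <;> linarith [hz.1, hz.2],
        ⟨h1.le, h2.le⟩, hz.1⟩
    have e1 : ∀ᶠ z in nhdsWithin x (Icc a b ∩ Iio x), y + ε / 8 < h z :=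
      hl.eventually (lt_mem_nhds hl1)
    have e2 : ∀ᶠ z in nhdsWithin x (Icc a b ∩ Ioi x), y + ε / 8 < h z :=
      hr.eventually (lt_mem_nhds hr1)
    have e3 : ∀ᶠ z in nhdsWithin x (Icc a b \ {x}), y + ε / 8 < h z := by
      have hs : Icc a b \ {x} = (Icc a b ∩ Iio x) ∪ (Icc a b ∩ Ioi x) := by
        rw [← inter_union_distrib_left, Iio_union_Ioi, sdiff_eq]
      rw [hs, nhdsWithin_union]
      exact eventually_sup.2 ⟨e1, e2⟩
    obtain ⟨δ, hδ, H⟩ := (hmem _ _).1 e3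
    have := K2 x ⟨hax.le, hxb.le⟩ (y + ε / 8) δ hδ (fun z h1 h2 h3 => (H z h1 h2 h3).le)
    linarith
  · rintro ⟨x, y⟩ ⟨hax, hxb, hy⟩
    simp only at hax hxb hy
    obtain ⟨c, hc, ε, hε, H⟩ := K1 x y hy
    have hΩ' : ∀ z w, a < z → z < b → z ≠ x → |z - x| < ε → w < c → (z, w) ∈ Ω := by
      intro z w h1 h2 h3 h4 h5
      rw [hΩ]
      exact ⟨h1, h2, h5.trans (H z ⟨h1.le, h2.le⟩ h3 h4)⟩
    rw [mem_interior]
    refine ⟨(Ioo a b ∩ Metric.ball x ε) ×ˢ Iio c, ?_,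
      (isOpen_Ioo.inter Metric.isOpen_ball).prod isOpen_Iio,
      ⟨⟨⟨hax, hxb⟩, Metric.mem_ball_self hε⟩, hc⟩⟩
    rintro ⟨z, w⟩ ⟨⟨hz1, hz2⟩, hw⟩
    have hw' : w < c := hw
    have hz1' : a < z ∧ z < b := hz1
    by_cases hzx : z = x
    · rw [Metric.mem_closure_iff]
      intro η hη
      have h1 : x < min b (x + min ε η / 2) := lt_min hxb (by linarith [lt_min hε hη])
      obtain ⟨t, ht1, ht2⟩ := exists_between h1
      have q1 := ht2.trans_le (min_le_left _ _)
      have q2 := ht2.trans_le (min_le_right _ _)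
      have m1 := min_le_left ε η
      have m2 := min_le_right ε η
      have m3 := lt_min hε hη
      refine ⟨(t, w), hΩ' t w (by linarith) q1 ht1.ne'
        (by rw [abs_lt]; constructor <;> linarith) hw', ?_⟩
      rw [Prod.dist_eq, hzx]
      refine max_lt ?_ (by simpa using hη)
      rw [Real.dist_eq, abs_lt]
      constructor <;> simp only <;> linarith
    · exact subset_closure (hΩ' z w hz1'.1 hz1'.2 hzx (by simpa [Real.dist_eq] using hz2) hw')
end

section
/- Let a < b and let h : [a,b] → [0,∞) be lower semicontinuous with finite pointwise variation. Define Ω_h := {(x,y) ∈ ℝ² : a < x < b, y < h(x)}, h⁻(x) := liminf_{z → x} h(z), and h⁺(x) := limsup_{z → x} h(z). Then the topological boundary of the closure of Ω_h, intersected with the open strip (a,b) × ℝ, equals {(x,y) ∈ ℝ² : a < x < b, h⁻(x) ≤ y ≤ h⁺(x)}. -/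
open MeasureTheory Filter Set


lemma aux_key (a b : ℝ) 
    (h : ℝ → ℝ) (hnonneg : ∀ x ∈ Icc a b, 0 ≤ h x)
    (hlsc : LowerSemicontinuousOn h (Icc a b))
    (hbv : BoundedVariationOn h (Icc a b)) (x : ℝ) (hx : x ∈ Ioo a b) (m M : ℝ)
    (hm : m = Filter.liminf h (nhdsWithin x (Icc a b \ {x})))
    (hM : M = Filter.limsup h (nhdsWithin x (Icc a b \ {x}))) :
    m ≤ M ∧ (∀ c > M, ∀ᶠ z in nhds x, h z < c) ∧ (∀ c < M, ∃ᶠ z in nhds x, c < h z) ∧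
    (∀ c < m, ∀ᶠ z in nhdsWithin x {x}ᶜ, c < h z) ∧
    (∀ c > m, ∃ᶠ z in nhds x, ∀ᶠ w in nhds z, h w < c) := by
  have hI : Icc a b ∈ nhds x := Icc_mem_nhds hx.1 hx.2
  have hF : nhdsWithin x (Icc a b \ {x}) = nhdsWithin x {x}ᶜ := by
    rw [sdiff_eq, inter_comm]; exact nhdsWithin_inter_of_mem' (mem_nhdsWithin_of_mem_nhds hI)
  rw [hF] at hm hM
  have hxI : x ∈ Icc a b := Ioo_subset_Icc_self hx
  have hIF : ∀ᶠ z in nhdsWithin x {x}ᶜ, z ∈ Icc a b := mem_nhdsWithin_of_mem_nhds hI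
  have bb : (nhdsWithin x {x}ᶜ).IsBoundedUnder (· ≥ ·) h :=
    ⟨0, by rw [eventually_map]; exact hIF.mono fun z hz => hnonneg z hz⟩
  have ba : (nhdsWithin x {x}ᶜ).IsBoundedUnder (· ≤ ·) h :=
    ⟨h x + (eVariationOn h (Icc a b)).toReal, by
      rw [eventually_map]
      refine hIF.mono fun z hz => ?_
      have := hbv.sub_le hz hxI
      linarith⟩
  have hmM : m ≤ M := by rw [hm, hM]; exact liminf_le_limsup ba bb
  have hxm : h x ≤ m := by
    refine le_of_forall_lt fun c hc => ?_
    obtain ⟨d, hcd, hd⟩ := exists_between hc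
    refine hcd.trans_le ?_
    rw [hm]
    refine le_liminf_of_le ba.isCoboundedUnder_ge ?_
    have := hlsc x hxI d hd
    rw [nhdsWithin_eq_nhds.2 hI] at this
    exact (this.filter_mono nhdsWithin_le_nhds).mono fun z hz => hz.le
  refine ⟨hmM, ?_, ?_, ?_, ?_⟩
  · intro c hc
    have h1 : ∀ᶠ z in nhdsWithin x {x}ᶜ, h z < c :=
      eventually_lt_of_limsup_lt (by rw [← hM]; exact hc) ba
    rw [eventually_nhdsWithin_iff] at h1
    filter_upwards [h1] with z hz
    by_cases hzx : z = x
    · subst hzx; linarith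
    · exact hz hzx
  · intro c hc
    exact (frequently_lt_of_lt_limsup bb.isCoboundedUnder_le (by rw [← hM]; exact hc)).filter_mono
      nhdsWithin_le_nhds
  · intro c hc
    exact eventually_lt_of_lt_liminf (by rw [← hm]; exact hc) bb
  · intro c hc
    obtain ⟨L, hL⟩ := hbv.exists_tendsto_left x
    obtain ⟨R, hR⟩ := hbv.exists_tendsto_right x
    rw [inter_comm, nhdsWithin_inter_of_mem' (mem_nhdsWithin_of_mem_nhds hI)] at hL hR
    have hmin : min L R ≤ m := by
      refine le_of_forall_lt fun c hc => ?_
      obtain ⟨d, hcd, hd⟩ := exists_between hc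
      refine hcd.trans_le ?_
      rw [hm]
      refine le_liminf_of_le ba.isCoboundedUnder_ge ?_
      rw [← Iio_union_Ioi, nhdsWithin_union, eventually_sup]
      exact ⟨(hL.eventually_const_lt (hd.trans_le (min_le_left _ _))).mono fun z hz => hz.le,
        (hR.eventually_const_lt (hd.trans_le (min_le_right _ _))).mono fun z hz => hz.le⟩
    have hc' : min L R < c := hmin.trans_lt hc
    rcases min_lt_iff.1 hc' with h1 | h1
    · have h2 := eventually_eventually_nhdsWithin.2 (hL.eventually_lt_const h1)
      have h3 := h2.and self_mem_nhdsWithin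
      refine (Eventually.frequently (h3.mono ?_)).filter_mono nhdsWithin_le_nhds
      rintro z ⟨hz, hzx⟩
      rwa [isOpen_Iio.nhdsWithin_eq hzx] at hz
    · have h2 := eventually_eventually_nhdsWithin.2 (hR.eventually_lt_const h1)
      have h3 := h2.and self_mem_nhdsWithin
      refine (Eventually.frequently (h3.mono ?_)).filter_mono nhdsWithin_le_nhds
      rintro z ⟨hz, hzx⟩
      rwa [isOpen_Ioi.nhdsWithin_eq hzx] at hz

/-- For a lower semicontinuous `h : [a,b] → [0,∞)` of finite pointwise variation, the part
of the topological boundary of the closure of the subgraph `Ω_h` lying in the open strip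
`(a,b) × ℝ` is `{(x,y) : a < x < b, h⁻(x) ≤ y ≤ h⁺(x)}`. -/
theorem stmt_11 (a b : ℝ) (hab : a < b)
    (h : ℝ → ℝ) (hnonneg : ∀ x ∈ Icc a b, 0 ≤ h x)
    (hlsc : LowerSemicontinuousOn h (Icc a b))
    (hbv : BoundedVariationOn h (Icc a b))
    (Ω : Set (ℝ × ℝ)) (hΩ : Ω = {p : ℝ × ℝ | a < p.1 ∧ p.1 < b ∧ p.2 < h p.1})
    (hm hp : ℝ → ℝ)
    (hhm : ∀ x, hm x = Filter.liminf h (nhdsWithin x (Icc a b \ {x})))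
    (hhp : ∀ x, hp x = Filter.limsup h (nhdsWithin x (Icc a b \ {x}))) :
    frontier (closure Ω) ∩ (Ioo a b ×ˢ (univ : Set ℝ))
      = {p : ℝ × ℝ | a < p.1 ∧ p.1 < b ∧ hm p.1 ≤ p.2 ∧ p.2 ≤ hp p.1} := by
  have key := fun x hx => aux_key a b h hnonneg hlsc hbv x hx (hm x) (hp x) (hhm x) (hhp x)
  have notcl : ∀ x y c, c < y → (∀ᶠ z in nhds x, h z < c) → (x, y) ∉ closure Ω := by
    intro x y c hcy hz hcl
    rw [mem_closure_iff_frequently] at hcl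
    apply hcl
    rw [nhds_prod_eq]
    filter_upwards [hz.prod_mk (lt_mem_nhds hcy)] with q hq
    rw [hΩ]
    rintro ⟨-, -, h3⟩
    linarith [hq.1, hq.2]
  have hcl : ∀ x ∈ Ioo a b, ∀ y, (x, y) ∈ closure Ω ↔ y ≤ hp x := by
    intro x hx y
    obtain ⟨-, hA, hB, -, -⟩ := key x hx
    constructor
    · intro hmem
      by_contra! hlt
      obtain ⟨c, hc1, hc2⟩ := exists_between hlt
      exact notcl x y c hc2 (hA c hc1) hmem
    · intro hy
      rw [Metric.mem_closure_iff]
      intro ε hε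
      obtain ⟨z, hz, hzx, hzI⟩ := ((hB (y - ε / 2) (by linarith)).and_eventually
        (Filter.inter_mem (Metric.ball_mem_nhds x hε) (Ioo_mem_nhds hx.1 hx.2))).exists
      refine ⟨(z, y - ε / 2), ?_, ?_⟩
      · rw [hΩ]; exact ⟨hzI.1, hzI.2, hz⟩
      · rw [Prod.dist_eq, max_lt_iff]
        refine ⟨by rw [dist_comm]; exact hzx, ?_⟩
        rw [Real.dist_eq]
        simp only [sub_sub_cancel]
        rw [abs_of_pos (by linarith)]; linarith
  have hint : ∀ x ∈ Ioo a b, ∀ y, (x, y) ∈ interior (closure Ω) ↔ y < hm x := by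
    intro x hx y
    obtain ⟨hmM, -, -, hC, hD⟩ := key x hx
    rw [mem_interior_iff_mem_nhds, nhds_prod_eq]
    constructor
    · intro hmem
      by_contra! hle
      obtain ⟨U, hU, V, hV, hUV⟩ := mem_prod_iff.1 hmem
      obtain ⟨y', hyy', hy'⟩ : ∃ y', y < y' ∧ y' ∈ V := by
        obtain ⟨ε, hε, hb⟩ := Metric.mem_nhds_iff.1 hV
        refine ⟨y + ε / 2, by linarith, hb ?_⟩
        rw [Metric.mem_ball, Real.dist_eq, add_sub_cancel_left, abs_of_pos (by linarith)]
        linarith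
      obtain ⟨c, hc1, hc2⟩ := exists_between hyy'
      obtain ⟨z, hz, hzU⟩ := ((hD c (hle.trans_lt hc1)).and_eventually hU).exists
      exact notcl z y' c hc2 hz (hUV ⟨hzU, hy'⟩)
    · intro hy
      obtain ⟨c, hc1, hc2⟩ := exists_between hy
      have h1 := hC c hc2
      rw [eventually_nhdsWithin_iff] at h1
      filter_upwards [(h1.and (Ioo_mem_nhds hx.1 hx.2)).prod_mk (gt_mem_nhds hc1)] with q hq
      obtain ⟨z, w⟩ := q
      obtain ⟨⟨hz, hzI⟩, hw⟩ := hq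
      by_cases hzx : z = x
      · subst hzx
        exact (hcl z hx w).2 (by simp only at hw; linarith)
      · apply subset_closure
        rw [hΩ]
        exact ⟨hzI.1, hzI.2, lt_trans hw (hz hzx)⟩
  ext ⟨x, y⟩
  simp only [frontier, closure_closure, mem_inter_iff, Set.mem_sdiff, mem_prod, mem_univ, and_true,
    mem_ofPred_eq]
  constructor
  · rintro ⟨⟨h1, h2⟩, hx⟩
    rw [hcl x hx] at h1
    rw [hint x hx, not_lt] at h2
    exact ⟨hx.1, hx.2, h2, h1⟩
  · rintro ⟨h1, h2, h3, h4⟩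
    have hx : x ∈ Ioo a b := ⟨h1, h2⟩
    rw [hcl x hx, hint x hx, not_lt]
    exact ⟨⟨h4, h3⟩, hx⟩
end

section
/- Let a < b and let h : [a,b] → [0,∞) be lower semicontinuous with finite pointwise variation. Define Ω_h := {(x,y) ∈ ℝ² : a < x < b, y < h(x)}, Γ_h := ∂Ω_h ∩ ((a,b)×ℝ), and Γ̃_h := ∂(cl Ω_h) ∩ ((a,b)×ℝ). Then both Γ_h and Γ̃_h are connected subsets of ℝ². -/
open MeasureTheory Filter Set

lemma aux_conn (a b : ℝ) (hab : a < b) (m M : ℝ) (U : Set (ℝ × ℝ))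
    (hlow : ∀ (x y c : ℝ), 0 ≤ c → (x, y) ∈ U → (x, y - c) ∈ U)
    (hm : ∀ x ∈ Ioo a b, ∀ y, y < m → (x, y) ∈ U)
    (hM : ∀ p ∈ U, p.2 ≤ M) :
    IsConnected (frontier U ∩ (Ioo a b ×ˢ (univ : Set ℝ))) := by
  have hcl : ∀ (x y c : ℝ), 0 ≤ c → (x, y) ∈ closure U → (x, y - c) ∈ closure U := by
    intro x y c hc hp
    have := map_mem_closure (f := fun q : ℝ × ℝ => (q.1, q.2 - c)) (t := U)
      (by fun_prop) hp (fun q hq => hlow q.1 q.2 c hc hq)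
    simpa using this
  have hint : ∀ (x y c : ℝ), 0 ≤ c → (x, y) ∈ interior U → (x, y - c) ∈ interior U := by
    intro x y c hc hp
    have hopen : IsOpen ((fun q : ℝ × ℝ => (q.1, q.2 + c)) ⁻¹' interior U) :=
      isOpen_interior.preimage (by fun_prop)
    refine interior_maximal ?_ hopen ?_
    · intro q hq
      have := hlow q.1 (q.2 + c) c hc (interior_subset hq)
      simpa using this
    · simpa using hp
  have hmi : ∀ x ∈ Ioo a b, ∀ y, y < m → (x, y) ∈ interior U := by
    intro x hx y hy
    refine interior_maximal (s := U) (t := Ioo a b ×ˢ Iio m) ?_ (isOpen_Ioo.prod isOpen_Iio) ⟨hx, hy⟩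
    rintro ⟨u, v⟩ ⟨hu, hv⟩
    exact hm u hu v hv
  have hMc : ∀ p ∈ closure U, p.2 ≤ M := by
    intro p hp
    exact closure_minimal (t := {p : ℝ × ℝ | p.2 ≤ M}) hM
      (isClosed_le continuous_snd continuous_const) hp
  have hbd : ∀ x ∈ Ioo a b, ∀ y, (x, y) ∈ frontier U → y ∈ Icc m M := by
    intro x hx y hy
    refine ⟨?_, hMc _ hy.1⟩
    by_contra hlt
    exact hy.2 (hmi x hx y (not_le.1 hlt))
  have hne : ∀ x ∈ Ioo a b, ∃ y, (x, y) ∈ frontier U := by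
    intro x hx
    have hpre : IsPreconnected ((fun y : ℝ => (x, y)) '' univ) :=
      isPreconnected_univ.image _ (by fun_prop)
    by_contra hcon
    push Not at hcon
    obtain ⟨p, -, hp1, hp2⟩ := hpre (interior U) (closure U)ᶜ isOpen_interior
      isClosed_closure.isOpen_compl
      (by
        rintro _ ⟨y, -, rfl⟩
        by_cases hc : (x, y) ∈ closure U
        · left
          by_contra hi
          exact hcon y ⟨hc, hi⟩
        · exact Or.inr hc)
      ⟨(x, m - 1), ⟨m - 1, trivial, rfl⟩, hmi x hx _ (by linarith)⟩
      ⟨(x, M + 1), ⟨M + 1, trivial, rfl⟩, fun hU => by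
        have := hMc _ hU
        simp only at this
        linarith⟩
    exact hp2 (subset_closure (interior_subset hp1))
  have hfib : ∀ x : ℝ, IsPreconnected {y : ℝ | (x, y) ∈ frontier U} := by
    intro x
    apply Set.OrdConnected.isPreconnected
    refine ⟨fun y hy z hz w hw => ⟨?_, fun hi => hy.2 ?_⟩⟩
    · have := hcl x z (z - w) (by linarith [hw.2]) hz.1
      simpa using this
    · have := hint x w (w - y) (by linarith [hw.1]) hi
      simpa using this
  constructor
  · obtain ⟨x, hx⟩ := nonempty_Ioo.2 hab
    obtain ⟨y, hy⟩ := hne x hx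
    exact ⟨(x, y), hy, hx, trivial⟩
  · rw [isPreconnected_closed_iff]
    rintro t t' ht ht' hcov ⟨p, ⟨hp, hpx, -⟩, hpt⟩ ⟨q, ⟨hq, hqx, -⟩, hqt⟩
    have hA : ∀ s : Set (ℝ × ℝ), IsClosed s →
        IsClosed (Prod.fst '' ((Icc a b ×ˢ Icc m M) ∩ (frontier U ∩ s))) := by
      intro s hs
      exact (((isCompact_Icc.prod isCompact_Icc).inter_right
        (isClosed_frontier.inter hs)).image continuous_fst).isClosed
    have hmem : ∀ s : Set (ℝ × ℝ), ∀ p : ℝ × ℝ, p ∈ frontier U → p.1 ∈ Ioo a b → p ∈ s →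
        p.1 ∈ Prod.fst '' ((Icc a b ×ˢ Icc m M) ∩ (frontier U ∩ s)) := by
      intro s p hp hx hs
      exact ⟨p, ⟨⟨Ioo_subset_Icc_self hx, hbd p.1 hx p.2 hp⟩, hp, hs⟩, rfl⟩
    obtain ⟨x, hx, ⟨⟨x1, y1⟩, ⟨-, h1, h1t⟩, e1⟩, ⟨⟨x2, y2⟩, ⟨-, h2, h2t⟩, e2⟩⟩ :=
      isPreconnected_closed_iff.1 (isPreconnected_Ioo (a := a) (b := b)) _ _ (hA t ht) (hA t' ht')
      (by
        intro x hx
        obtain ⟨y, hy⟩ := hne x hx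
        rcases hcov ⟨hy, hx, trivial⟩ with hh | hh
        · exact Or.inl (hmem t (x, y) hy hx hh)
        · exact Or.inr (hmem t' (x, y) hy hx hh))
      ⟨p.1, hpx, hmem t p hp hpx hpt⟩ ⟨q.1, hqx, hmem t' q hq hqx hqt⟩
    simp only at e1 e2
    subst e1 e2
    obtain ⟨y, hy, hyt, hyt'⟩ := isPreconnected_closed_iff.1 (hfib x2)
      ((fun y : ℝ => (x2, y)) ⁻¹' t) ((fun y : ℝ => (x2, y)) ⁻¹' t')
      (ht.preimage (by fun_prop)) (ht'.preimage (by fun_prop))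
      (fun y hy => hcov ⟨hy, hx, trivial⟩) ⟨y1, h1, h1t⟩ ⟨y2, h2, h2t⟩
    exact ⟨(x2, y), ⟨hy, hx, trivial⟩, hyt, hyt'⟩


open MeasureTheory Filter Set

/-- For a lower semicontinuous `h : [a,b] → [0,∞)` of finite pointwise variation, both the
profile `Γ_h := ∂Ω_h ∩ ((a,b)×ℝ)` and the reduced profile `Γ̃_h := ∂(cl Ω_h) ∩ ((a,b)×ℝ)`
are connected. -/
theorem stmt_12 (a b : ℝ) (hab : a < b)
    (h : ℝ → ℝ) (hnonneg : ∀ x ∈ Icc a b, 0 ≤ h x)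
    (hlsc : LowerSemicontinuousOn h (Icc a b))
    (hbv : BoundedVariationOn h (Icc a b))
    (Ω : Set (ℝ × ℝ)) (hΩ : Ω = {p : ℝ × ℝ | a < p.1 ∧ p.1 < b ∧ p.2 < h p.1}) :
    IsConnected (frontier Ω ∩ (Ioo a b ×ˢ (univ : Set ℝ)))
      ∧ IsConnected (frontier (closure Ω) ∩ (Ioo a b ×ˢ (univ : Set ℝ))) := by
  have hlow : ∀ (x y c : ℝ), 0 ≤ c → (x, y) ∈ Ω → (x, y - c) ∈ Ω := by
    subst hΩ
    rintro x y c hc ⟨h1, h2, h3⟩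
    exact ⟨h1, h2, by simp only at h3 ⊢; linarith⟩
  have hm : ∀ x ∈ Ioo a b, ∀ y, y < 0 → (x, y) ∈ Ω := by
    subst hΩ
    intro x hx y hy
    exact ⟨hx.1, hx.2, lt_of_lt_of_le hy (hnonneg x (Ioo_subset_Icc_self hx))⟩
  obtain ⟨M, hM⟩ : ∃ M, ∀ p ∈ Ω, p.2 ≤ M := by
    subst hΩ
    refine ⟨h a + (eVariationOn h (Icc a b)).toReal, ?_⟩
    rintro ⟨x, y⟩ ⟨h1, h2, h3⟩
    have := hbv.sub_le (x := x) (y := a) ⟨h1.le, h2.le⟩ ⟨le_rfl, hab.le⟩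
    simp only at h3 ⊢
    linarith
  refine ⟨aux_conn a b hab 0 M Ω hlow hm hM, aux_conn a b hab 0 M (closure Ω) ?_
    (fun x hx y hy => subset_closure (hm x hx y hy)) ?_⟩
  · intro x y c hc hp
    have := map_mem_closure (f := fun q : ℝ × ℝ => (q.1, q.2 - c)) (t := Ω)
      (by fun_prop) hp (fun q hq => hlow q.1 q.2 c hc hq)
    simpa using this
  · intro p hp
    exact closure_minimal (t := {p : ℝ × ℝ | p.2 ≤ M}) hM
      (isClosed_le continuous_snd continuous_const) hp
end

section
/- Let a < b and let h : [a,b] → [0,∞) be lower semicontinuous. Define Ω_h := {(x,y) ∈ ℝ² : a < x < b, y < h(x)} and Γ_h := ∂Ω_h ∩ ((a,b)×ℝ). Then h has finite pointwise variation if and only if the one-dimensional Hausdorff measure H¹(Γ_h) is finite. -/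
open MeasureTheory Filter Set

lemma aux_frontier {X : Type*} [TopologicalSpace X] {S Ω : Set X} (hS : IsPreconnected S)
    {p q : X} (hp : p ∈ S) (hq : q ∈ S) (hpΩ : p ∈ Ω) (hqΩ : q ∉ Ω) :
    (S ∩ frontier Ω).Nonempty := by
  by_contra hne
  have hno : ∀ z ∈ S, z ∉ frontier Ω := fun z hz hf => hne ⟨z, hz, hf⟩
  have key : ∀ z ∈ S, z ∈ closure Ω → z ∈ interior Ω := by
    intro z hz hc
    by_contra hi
    exact hno z hz ⟨hc, hi⟩
  obtain ⟨z, hz, hz1, hz2⟩ := hS (interior Ω) (closure Ω)ᶜ isOpen_interior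
    isClosed_closure.isOpen_compl
    (by
      intro z hz
      by_cases hc : z ∈ closure Ω
      · exact Or.inl (key z hz hc)
      · exact Or.inr hc)
    ⟨p, hp, key p hp (subset_closure hpΩ)⟩
    ⟨q, hq, fun hc => hqΩ (interior_subset (key q hq hc))⟩
  exact hz2 (subset_closure (interior_subset hz1))

lemma aux_lip_coord (i : Fin 2) :
    LipschitzWith 1 (fun p : EuclideanSpace ℝ (Fin 2) => p i) := by
  refine LipschitzWith.of_dist_le_mul fun p q => ?_
  rw [EuclideanSpace.dist_eq]
  simp only [NNReal.coe_one, one_mul]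
  refine Real.le_sqrt_of_sq_le ?_
  exact Finset.single_le_sum (f := fun i => dist (p i) (q i) ^ 2)
    (fun j _ => sq_nonneg _) (Finset.mem_univ i)

lemma aux_lip_pair (g f : ℝ → ℝ) (hg : LipschitzWith 1 g) (hf : LipschitzWith 1 f) :
    LipschitzWith 2 (fun t => (!₂[g t, f t] : EuclideanSpace ℝ (Fin 2))) := by
  refine LipschitzWith.of_dist_le_mul fun p q => ?_
  rw [EuclideanSpace.dist_eq]
  have h1 := hg.dist_le_mul p q
  have h2 := hf.dist_le_mul p q
  simp only [NNReal.coe_one, one_mul] at h1 h2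
  refine Real.sqrt_le_iff.2 ⟨by positivity, ?_⟩
  simp [Fin.sum_univ_two]
  have := dist_nonneg (x := g p) (y := g q)
  have := dist_nonneg (x := f p) (y := f q)
  nlinarith

lemma aux_inverse (a b : ℝ) (hab : a < b) (s : ℝ → ℝ)
    (hs : ∀ x ∈ Icc a b, ∀ y ∈ Icc a b, x ≤ y → y - x ≤ s y - s x) :
    ∃ g : ℝ → ℝ, Monotone g ∧ LipschitzWith 1 g ∧ ∀ x ∈ Icc a b, g (s x) = x := by
  have : Nonempty (Icc a b) := ⟨⟨a, left_mem_Icc.2 hab.le⟩⟩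
  have hbdd : ∀ t, BddBelow (range fun x : Icc a b => (x : ℝ) + max (t - s x) 0) := by
    intro t
    refine ⟨a, ?_⟩
    rintro _ ⟨x, rfl⟩
    have := x.2.1
    have := le_max_right (t - s x) 0
    simp only
    linarith
  refine ⟨fun t => ⨅ x : Icc a b, ((x : ℝ) + max (t - s x) 0), ?_, ?_, ?_⟩
  · intro t t' htt
    refine ciInf_mono (hbdd t) fun x => ?_
    gcongr
  · refine LipschitzWith.of_le_add fun t t' => ?_
    rw [← sub_le_iff_le_add]
    refine le_ciInf fun x => ?_
    rw [sub_le_iff_le_add]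
    refine (ciInf_le (hbdd t) x).trans ?_
    have h1 : t - t' ≤ dist t t' := le_abs_self _
    have h2 : 0 ≤ dist t t' := dist_nonneg
    have h3 : max (t - s x) 0 ≤ max (t' - s x) 0 + dist t t' := by
      refine max_le ?_ ?_
      · have := le_max_left (t' - s x) 0
        linarith
      · have := le_max_right (t' - s x) 0
        linarith
    linarith
  · intro y hy
    refine le_antisymm ?_ ?_
    · refine (ciInf_le (hbdd _) ⟨y, hy⟩).trans ?_
      simp
    · refine le_ciInf fun x => ?_
      rcases le_total (x : ℝ) y with hxy | hxy
      · have := hs x x.2 y hy hxy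
        have := le_max_left (s y - s x) 0
        linarith
      · have := le_max_right (s y - s x) 0
        linarith

lemma aux_forward (a b : ℝ) (hab : a < b)
    (h : ℝ → ℝ) 
    (hlsc : LowerSemicontinuousOn h (Icc a b))
    (Ω : Set (EuclideanSpace ℝ (Fin 2)))
    (hΩ : Ω = {p : EuclideanSpace ℝ (Fin 2) | a < p 0 ∧ p 0 < b ∧ p 1 < h (p 0)})
    (hbv : BoundedVariationOn h (Icc a b)) :
    μH[1] (frontier Ω ∩ {p : EuclideanSpace ℝ (Fin 2) | a < p 0 ∧ p 0 < b}) < ⊤ := by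
  have hc0 : Continuous (fun p : EuclideanSpace ℝ (Fin 2) => p 0) := (aux_lip_coord 0).continuous
  have hc1 : Continuous (fun p : EuclideanSpace ℝ (Fin 2) => p 1) := (aux_lip_coord 1).continuous
  have hloc := hbv.locallyBoundedVariationOn
  have ha : a ∈ Icc a b := left_mem_Icc.2 hab.le
  have hb : b ∈ Icc a b := right_mem_Icc.2 hab.le
  set v := variationOnFromTo h (Icc a b) a with hv
  have hvm : MonotoneOn v (Icc a b) := variationOnFromTo.monotoneOn hloc ha
  have hvd : ∀ x ∈ Icc a b, ∀ y ∈ Icc a b, x ≤ y → |h x - h y| ≤ v y - v x := by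
    intro x hx y hy hxy
    rw [hv, variationOnFromTo.sub_right hloc ha hy hx, variationOnFromTo.eq_of_le _ _ hxy,
      ← Real.dist_eq, dist_edist]
    refine ENNReal.toReal_mono (hloc x y hx hy) ?_
    exact eVariationOn.edist_le _ ⟨hx, left_mem_Icc.2 hxy⟩ ⟨hy, right_mem_Icc.2 hxy⟩
  set s : ℝ → ℝ := fun x => x + v x with hs
  have hsx : ∀ x ∈ Icc a b, ∀ y ∈ Icc a b, x ≤ y → y - x ≤ s y - s x := by
    intro x hx y hy hxy
    have := hvm hx hy hxy
    simp only [hs]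
    linarith
  have hsmono : MonotoneOn s (Icc a b) := by
    intro x hx y hy hxy
    have := hsx x hx y hy hxy
    linarith
  have hsh : ∀ x ∈ Icc a b, ∀ y ∈ Icc a b, |h x - h y| ≤ |s x - s y| := by
    have main : ∀ x ∈ Icc a b, ∀ y ∈ Icc a b, x ≤ y → |h x - h y| ≤ |s x - s y| := by
      intro x hx y hy hxy
      rw [abs_sub_comm (s x)]
      refine le_trans ?_ (le_abs_self _)
      have := hvd x hx y hy hxy
      simp only [hs]
      linarith
    intro x hx y hy
    rcases le_total x y with hxy | hxy
    · exact main x hx y hy hxy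
    · rw [abs_sub_comm (h x), abs_sub_comm (s x)]
      exact main y hy x hx hxy
  obtain ⟨g, hgm, hgl, hgs⟩ := aux_inverse a b hab s hsx
  have hlipon : LipschitzOnWith 1 (h ∘ g) (s '' Icc a b) := by
    refine LipschitzOnWith.of_dist_le_mul ?_
    rintro _ ⟨x, hx, rfl⟩ _ ⟨y, hy, rfl⟩
    simp only [Function.comp, hgs x hx, hgs y hy, NNReal.coe_one, one_mul, Real.dist_eq]
    exact hsh x hx y hy
  obtain ⟨f, hfl, hfe⟩ := hlipon.extend_real
  have hfs : ∀ x ∈ Icc a b, f (s x) = h x := by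
    intro x hx
    rw [← hfe ⟨x, hx, rfl⟩]
    simp [hgs x hx]
  have hopen : IsOpen Ω := by
    rw [isOpen_iff_mem_nhds, hΩ]
    rintro p ⟨h1, h2, h3⟩
    obtain ⟨c, hc1', hc2'⟩ := exists_between h3
    have e1 : ∀ᶠ z in nhds (p 0), c < h z := by
      have := hlsc (p 0) ⟨h1.le, h2.le⟩ c hc2'
      rwa [nhdsWithin_eq_nhds.2 (Icc_mem_nhds h1 h2)] at this
    filter_upwards [hc0.continuousAt.eventually e1,
      hc0.continuousAt.eventually (Ioo_mem_nhds h1 h2),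
      hc1.continuousAt.eventually (Iio_mem_nhds hc1')] with q q1 q2 q3
    exact ⟨q2.1, q2.2, lt_trans q3 q1⟩
  have hsub : frontier Ω ∩ {p : EuclideanSpace ℝ (Fin 2) | a < p 0 ∧ p 0 < b} ⊆
      (fun t => (!₂[g t, f t] : EuclideanSpace ℝ (Fin 2))) '' Icc (s a) (s b) := by
    rintro p ⟨hpf, hp1, hp2⟩
    have hpI : p 0 ∈ Icc a b := ⟨hp1.le, hp2.le⟩
    have hge : h (p 0) ≤ p 1 := by
      by_contra hlt
      have : p ∈ Ω := by rw [hΩ]; exact ⟨hp1, hp2, not_le.1 hlt⟩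
      rw [hopen.frontier_eq] at hpf
      exact hpf.2 this
    obtain ⟨q, hq, hqt⟩ := mem_closure_iff_seq_limit.1 (frontier_subset_closure hpf)
    have hqΩ : ∀ n, a < q n 0 ∧ q n 0 < b ∧ q n 1 < h (q n 0) := by
      intro n
      have := hq n
      rw [hΩ] at this
      exact this
    have hqI : ∀ n, q n 0 ∈ Icc a b := fun n => ⟨(hqΩ n).1.le, (hqΩ n).2.1.le⟩
    have hsI : ∀ x ∈ Icc a b, s x ∈ Icc (s a) (s b) := fun x hx =>
      ⟨hsmono ha hx hx.1, hsmono hx hb hx.2⟩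
    obtain ⟨c, hc, φ, hφ, hlim⟩ := (isCompact_Icc (a := s a) (b := s b)).tendsto_subseq
      (x := fun n => s (q n 0)) (fun n => hsI _ (hqI n))
    have hqφ := hqt.comp hφ.tendsto_atTop
    have hl0 := (hc0.tendsto p).comp hqφ
    have hl1 := (hc1.tendsto p).comp hqφ
    have hgc : g c = p 0 := by
      refine tendsto_nhds_unique ((hgl.continuous.tendsto c).comp hlim) (hl0.congr fun n => ?_)
      simp [hgs _ (hqI (φ n))]
    have hfc : p 1 ≤ f c := by
      refine le_of_tendsto_of_tendsto' hl1 ((hfl.continuous.tendsto c).comp hlim) fun n => ?_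
      simp only [Function.comp, hfs _ (hqI (φ n))]
      exact (hqΩ (φ n)).2.2.le
    have hivt := intermediate_value_uIcc (a := s (p 0)) (b := c) hfl.continuous.continuousOn
    obtain ⟨t, ht, htf⟩ := hivt (show p 1 ∈ uIcc (f (s (p 0))) (f c) by
      rw [hfs _ hpI]; exact mem_uIcc_of_le hge hfc)
    have htg : g t = p 0 := by
      have := hgm.monotoneOn (uIcc (s (p 0)) c) |>.mapsTo_uIcc ht
      rw [hgs _ hpI, hgc, uIcc_self] at this
      exact this
    refine ⟨t, ?_, ?_⟩
    · exact uIcc_subset_Icc (hsI _ hpI) hc ht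
    · ext i
      fin_cases i
      · simp [htg]
      · simp [htf]
  refine (measure_mono hsub).trans_lt ?_
  refine ((aux_lip_pair g f hgl hfl).hausdorffMeasure_image_le zero_le_one _).trans_lt ?_
  rw [hausdorffMeasure_real, Real.volume_Icc]
  simp
  exact ENNReal.mul_lt_top (by simp) ENNReal.ofReal_lt_top

lemma aux_backward (a b : ℝ) (hab : a < b)
    (h : ℝ → ℝ) (hnonneg : ∀ x ∈ Icc a b, 0 ≤ h x)
    (Ω : Set (EuclideanSpace ℝ (Fin 2)))
    (hΩ : Ω = {p : EuclideanSpace ℝ (Fin 2) | a < p 0 ∧ p 0 < b ∧ p 1 < h (p 0)})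
    (hfin : μH[1] (frontier Ω ∩ {p : EuclideanSpace ℝ (Fin 2) | a < p 0 ∧ p 0 < b}) < ⊤) :
    BoundedVariationOn h (Icc a b) := by
  have hc0 : Continuous (fun p : EuclideanSpace ℝ (Fin 2) => p 0) := (aux_lip_coord 0).continuous
  set Γ := frontier Ω ∩ {p : EuclideanSpace ℝ (Fin 2) | a < p 0 ∧ p 0 < b} with hΓ
  set ν : Measure ℝ := ((μH[1] : Measure (EuclideanSpace ℝ (Fin 2))).restrict Γ).map
    (fun p => p 0) with hν
  have hνS : ∀ S, MeasurableSet S →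
      ν S = μH[1] ((fun p : EuclideanSpace ℝ (Fin 2) => p 0) ⁻¹' S ∩ Γ) := by
    intro S hS
    rw [hν, Measure.map_apply hc0.measurable hS, Measure.restrict_apply (hc0.measurable hS)]
  have hνfin : IsFiniteMeasure ν := by
    refine ⟨?_⟩
    rw [hνS _ MeasurableSet.univ]
    simpa using hfin
  -- main estimate
  have key : ∀ u v w z, a < u → u < b → a < v → v < b → h w ≤ h z →
      (w = u ∧ z = v ∨ w = v ∧ z = u) → u ≤ v → ENNReal.ofReal (h z - h w) ≤ ν (Icc u v) := by
    intro u v w z hau hub hav hvb hwz hcase huv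
    rw [hνS _ measurableSet_Icc, ← Real.volume_Ioo, ← hausdorffMeasure_real]
    have hL := (aux_lip_coord 1).hausdorffMeasure_image_le zero_le_one
      ((fun p : EuclideanSpace ℝ (Fin 2) => p 0) ⁻¹' (Icc u v) ∩ Γ)
    simp only [NNReal.coe_one, ENNReal.coe_one, ENNReal.one_rpow, one_mul] at hL
    refine le_trans (measure_mono ?_) hL
    intro y hy
    have hw : w ∈ Icc u v := by
      rcases hcase with ⟨rfl, rfl⟩ | ⟨rfl, rfl⟩
      · exact left_mem_Icc.2 huv
      · exact right_mem_Icc.2 huv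
    have hz : z ∈ Icc u v := by
      rcases hcase with ⟨rfl, rfl⟩ | ⟨rfl, rfl⟩
      · exact right_mem_Icc.2 huv
      · exact left_mem_Icc.2 huv
    have hcont : Continuous (fun t : ℝ => (!₂[t, y] : EuclideanSpace ℝ (Fin 2))) := by
      fun_prop
    obtain ⟨p, ⟨t, ht, rfl⟩, hpf⟩ := aux_frontier (Ω := Ω)
      ((isPreconnected_Icc (a := u) (b := v)).image _ hcont.continuousOn)
      (mem_image_of_mem _ hz) (mem_image_of_mem _ hw)
      (by rw [hΩ]; exact ⟨by simpa using hau.trans_le hz.1, by simpa using hz.2.trans_lt hvb,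
            by simpa using hy.2⟩)
      (by rw [hΩ]; rintro ⟨-, -, h3⟩; exact absurd hy.1 (not_lt.2 (by simpa using h3.le)))
    refine ⟨_, ⟨?_, hpf, ?_⟩, ?_⟩
    · simpa using ht
    · exact ⟨by simpa using hau.trans_le ht.1, by simpa using ht.2.trans_lt hvb⟩
    · simp
  have key2 : ∀ u v, a < u → u < b → a < v → v < b → u ≤ v → |h u - h v| ≤ ν.real (Icc u v) := by
    intro u v hau hub hav hvb huv
    rw [Measure.real]
    rcases le_total (h u) (h v) with hh | hh
    · rw [abs_sub_comm, abs_of_nonneg (sub_nonneg.2 hh)]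
      exact (ENNReal.ofReal_le_iff_le_toReal (measure_ne_top _ _)).1
        (key u v u v hau hub hav hvb hh (Or.inl ⟨rfl, rfl⟩) huv)
    · rw [abs_of_nonneg (sub_nonneg.2 hh)]
      exact (ENNReal.ofReal_le_iff_le_toReal (measure_ne_top _ _)).1
        (key u v v u hau hub hav hvb hh (Or.inr ⟨rfl, rfl⟩) huv)
  set φ : ℝ → ℝ := fun x => ν.real (Iic x) + ν.real (Iio x) with hφ
  have hφm : Monotone φ := by
    intro x y hxy
    simp only [hφ]
    gcongr <;> exact measure_ne_top _ _
  have key3 : ∀ u v, u < v → ν.real (Icc u v) ≤ φ v - φ u := by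
    intro u v huv
    have e1 : ν.real (Iic v) = ν.real (Iic u) + ν.real (Ioc u v) := by
      rw [← measureReal_union _ measurableSet_Ioc, Iic_union_Ioc_eq_Iic huv.le]
      exact (Iic_disjoint_Ioc le_rfl)
    have e2 : ν.real (Iio v) = ν.real (Iio u) + ν.real (Ico u v) := by
      rw [← measureReal_union _ measurableSet_Ico, Iio_union_Ico_eq_Iio huv.le]
      exact Set.disjoint_left.2 fun x hx hx' => absurd hx (not_lt.2 hx'.1)
    have e3 : ν.real (Icc u v) ≤ ν.real (Ioc u v) + ν.real (Ico u v) := by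
      refine le_trans (measureReal_mono ?_) (measureReal_union_le _ _)
      intro x hx
      rcases hx.1.eq_or_lt with hh | hh
      · exact Or.inr ⟨hx.1, hh ▸ huv⟩
      · exact Or.inl ⟨hh, hx.2⟩
    simp only [hφ]
    linarith
  -- bound for h
  obtain ⟨c, hc1, hc2⟩ := exists_between hab
  set M := h a + h b + h c + ν.real univ with hM
  have ha0 := hnonneg a (left_mem_Icc.2 hab.le)
  have hb0 := hnonneg b (right_mem_Icc.2 hab.le)
  have hc0' := hnonneg c ⟨hc1.le, hc2.le⟩
  have hu0 : 0 ≤ ν.real univ := measureReal_nonneg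
  have hhM : ∀ x ∈ Icc a b, h x ≤ M := by
    intro x hx
    rcases hx.1.eq_or_lt with rfl | hax
    · linarith
    rcases hx.2.eq_or_lt with rfl | hxb
    · linarith
    have : |h x - h c| ≤ ν.real univ := by
      rcases le_total x c with hxc | hxc
      · exact (key2 x c hax hxb hc1 hc2 hxc).trans (measureReal_mono (subset_univ _))
      · rw [abs_sub_comm]
        exact (key2 c x hc1 hc2 hax hxb hxc).trans (measureReal_mono (subset_univ _))
    have := le_abs_self (h x - h c)
    linarith
  have hM0 : 0 ≤ M := by positivity
  set ψ : ℝ → ℝ := fun x => φ x + (if a < x then M else 0) + (if b ≤ x then M else 0) with hψ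
  have hψm : Monotone ψ := by
    intro x y hxy
    have := hφm hxy
    simp only [hψ]
    split_ifs <;> linarith
  have key4 : ∀ u ∈ Icc a b, ∀ v ∈ Icc a b, u ≤ v → |h u - h v| ≤ ψ v - ψ u := by
    intro u hu v hv huv
    rcases huv.eq_or_lt with rfl | huv'
    · simp
    have hm := hφm huv
    have hd : |h u - h v| ≤ M := by
      rw [abs_le]
      have := hnonneg u hu
      have := hnonneg v hv
      have := hhM u hu
      have := hhM v hv
      constructor <;> linarith
    have hav : a < v := hu.1.trans_lt huv'
    have hub : u < b := huv'.trans_le hv.2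
    simp only [hψ, if_pos hav, if_neg hub.not_ge]
    rcases hu.1.eq_or_lt with hau | hau
    · rw [if_neg (show ¬ a < u from not_lt.2 hau.ge)]
      split_ifs <;> linarith
    rw [if_pos hau]
    rcases hv.2.eq_or_lt with hvb | hvb
    · rw [if_pos hvb.ge]
      linarith
    rw [if_neg hvb.not_ge]
    have := key2 u v hau hub hav hvb huv
    have := key3 u v huv'
    linarith
  have hfinal : eVariationOn h (Icc a b) ≤ eVariationOn ψ (Icc a b) := by
    unfold eVariationOn
    refine iSup_mono fun p => Finset.sum_le_sum fun i _ => ?_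
    have hmono : (p.2 : ℕ → ℝ) i ≤ (p.2 : ℕ → ℝ) (i + 1) := p.2.2.1 (Nat.le_succ i)
    rw [edist_dist, edist_dist]
    refine ENNReal.ofReal_le_ofReal ?_
    rw [dist_comm, Real.dist_eq, Real.dist_eq]
    exact (key4 _ (p.2.2.2 i) _ (p.2.2.2 (i+1)) hmono).trans (le_abs_self _)
  have hlast := (hψm.monotoneOn (Icc a b)).eVariationOn_le (left_mem_Icc.2 hab.le)
    (right_mem_Icc.2 hab.le)
  rw [inter_self] at hlast
  exact ((hfinal.trans hlast).trans_lt ENNReal.ofReal_lt_top).ne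

/-- For a lower semicontinuous `h : [a,b] → [0,∞)`, `h` has finite pointwise variation if and
only if the profile `Γ_h := ∂Ω_h ∩ ((a,b)×ℝ)` has finite one-dimensional Hausdorff measure
(in the Euclidean plane). -/
theorem stmt_13 (a b : ℝ) (hab : a < b)
    (h : ℝ → ℝ) (hnonneg : ∀ x ∈ Icc a b, 0 ≤ h x)
    (hlsc : LowerSemicontinuousOn h (Icc a b))
    (Ω : Set (EuclideanSpace ℝ (Fin 2)))
    (hΩ : Ω = {p : EuclideanSpace ℝ (Fin 2) | a < p 0 ∧ p 0 < b ∧ p 1 < h (p 0)}) :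
    BoundedVariationOn h (Icc a b)
      ↔ μH[1] (frontier Ω ∩ {p : EuclideanSpace ℝ (Fin 2) | a < p 0 ∧ p 0 < b}) < ⊤ :=
  ⟨aux_forward a b hab h hlsc Ω hΩ, aux_backward a b hab h hnonneg Ω hΩ⟩
end

section
/- Let a < b, let h : (a,b) → [0,∞) be integrable with ∫_a^b h(x) dx > 0, and let ε > 0. Then there exists t > 0 such that ∫_a^b min{h(x) + ε, t} dx = ∫_a^b h(x) dx. -/
open MeasureTheory Filter Set

/-- Existence of the truncation level `t > 0` such that the profile `min{h + ε, t}` encloses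
exactly the area `∫_a^b h`. -/
theorem stmt_14 (a b : ℝ) (hab : a < b)
    (h : ℝ → ℝ) (hint : IntegrableOn h (Ioo a b))
    (hnonneg : ∀ x ∈ Ioo a b, 0 ≤ h x)
    (hpos : 0 < ∫ x in Ioo a b, h x)
    (ε : ℝ) (hε : 0 < ε) :
    ∃ t > (0 : ℝ), ∫ x in Ioo a b, min (h x + ε) t = ∫ x in Ioo a b, h x := by
  have hc : IntegrableOn (fun _ : ℝ => ε) (Ioo a b) :=
    integrableOn_const (by simp)
  have hI : IntegrableOn (fun x => h x + ε) (Ioo a b) := hint.add hc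
  have hm : ∀ t : ℝ, AEStronglyMeasurable (fun x => min (h x + ε) |t|)
      (volume.restrict (Ioo a b)) := fun t =>
    hI.aestronglyMeasurable.inf aestronglyMeasurable_const
  have hb : ∀ t : ℝ, ∀ᵐ x ∂(volume.restrict (Ioo a b)), ‖min (h x + ε) |t|‖ ≤ h x + ε := by
    intro t
    filter_upwards [ae_restrict_mem measurableSet_Ioo] with x hx
    have h1 := hnonneg x hx
    rw [Real.norm_eq_abs, abs_of_nonneg (le_min (by linarith) (abs_nonneg t))]
    exact min_le_left _ _
  have hcont : Continuous (fun t : ℝ => ∫ x in Ioo a b, min (h x + ε) |t|) :=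
    continuous_of_dominated hm hb hI
      (Eventually.of_forall fun x => continuous_const.min continuous_abs)
  have hlim : Tendsto (fun t : ℝ => ∫ x in Ioo a b, min (h x + ε) |t|) atTop
      (nhds (∫ x in Ioo a b, (h x + ε))) := by
    refine tendsto_integral_filter_of_dominated_convergence (fun x => h x + ε)
      (Eventually.of_forall hm) (Eventually.of_forall hb) hI (Eventually.of_forall fun x => ?_)
    refine tendsto_const_nhds.congr' ?_
    filter_upwards [eventually_ge_atTop (h x + ε)] with t ht
    exact (min_eq_left (ht.trans (le_abs_self t))).symm
  have hlt : ∫ x in Ioo a b, h x < ∫ x in Ioo a b, (h x + ε) := by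
    rw [integral_add hint hc]
    have : 0 < (b - a) * ε := mul_pos (by linarith) hε
    simpa [hab.le] using this
  have h0 : ∫ x in Ioo a b, min (h x + ε) |(0 : ℝ)| = 0 := by
    rw [setIntegral_congr_fun (g := fun _ => (0 : ℝ)) measurableSet_Ioo]
    · simp
    · intro x hx
      have h1 := hnonneg x hx
      simp only [abs_zero]
      exact min_eq_right (by linarith)
  obtain ⟨T, hT⟩ := (hlim.eventually_const_lt hlt).exists
  obtain ⟨t, ht⟩ := mem_range_of_exists_le_of_exists_ge hcont
    ⟨0, h0.le.trans hpos.le⟩ ⟨T, hT.le⟩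
  refine ⟨|t|, abs_pos.2 ?_, ht⟩
  rintro rfl
  exact hpos.ne (h0.symm.trans ht)
end
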